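/- arXiv:1610.03381 — 7 statements merged into one kernel-verified Lean document; each statement's English description precedes it below -/
import Mathlib

section
/- Coefficients vanishing at infinity do not imply vanishing at infinity: let f : ℝ → ℂ be continuous with support contained in the open interval (0,1). Then lim_{x→+∞} Σ_{n=1}^∞ Σ_{k=0}^{n−1} (1/n) f(x − n − k/n) = ∫_0^1 f(t) dt. In particular, if ∫_0^1 f(t) dt ≠ 0, then the function x ↦ Σ_{n=1}^∞ Σ_{k=0}^{n−1} (1/n) f(x − n − k/n) does not belong to C₀(ℝ), so the measure ν = Σ_{n∈ℕ} Σ_{k=0}^{n−1} (1/n) δ_{n+k/n} does not vanish at infinity even though its coefficients 1/n tend to 0. -/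
open MeasureTheory Filter Topology

lemma riemann_unif (f : ℝ → ℂ) (hf : Continuous f) (hu : UniformContinuous f) (ε : ℝ) (hε : 0 < ε) :
    ∃ N : ℕ, 0 < N ∧ ∀ n : ℕ, N ≤ n → ∀ y : ℝ,
      ‖(∑ k ∈ Finset.range n, ((n : ℂ))⁻¹ * f (y - (k : ℝ) / (n : ℝ)))
        - ∫ s in (y - 1)..y, f s‖ ≤ ε := by
  obtain ⟨δ, hδ, h⟩ := Metric.uniformContinuous_iff.1 hu ε hε
  obtain ⟨N, hN⟩ := exists_nat_gt (1 / δ)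
  refine ⟨N + 1, by omega, fun n hn y => ?_⟩
  have hnpos : (0 : ℝ) < n := by
    have : 0 < n := by omega
    exact_mod_cast this
  have hn1 : 1 / δ < n := lt_of_lt_of_le hN (by exact_mod_cast (by omega : N ≤ n))
  have hnd : 1 / (n : ℝ) < δ := by
    rw [div_lt_iff₀ hδ] at hn1
    rw [div_lt_iff₀ hnpos]; linarith
  have hsum := intervalIntegral.sum_integral_adjacent_intervals (f := f) (μ := volume)
    (a := fun k : ℕ => y - (k : ℝ) / (n : ℝ)) (n := n)
    (fun k _ => hf.intervalIntegrable _ _)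
  have e1 : y - (n : ℝ) / n = y - 1 := by rw [div_self hnpos.ne']
  simp only [Nat.cast_zero, zero_div, sub_zero, e1] at hsum
  rw [intervalIntegral.integral_symm, ← hsum, sub_neg_eq_add, ← Finset.sum_add_distrib]
  have hb : ∀ k ∈ Finset.range n, ‖((n : ℂ))⁻¹ * f (y - (k : ℝ) / (n : ℝ)) +
      ∫ s in (y - (k : ℝ) / (n : ℝ))..(y - ((k + 1 : ℕ) : ℝ) / (n : ℝ)), f s‖ ≤ ε * (1 / n) := by
    intro k _
    have hlen : (y - ((k + 1 : ℕ) : ℝ) / (n : ℝ)) - (y - (k : ℝ) / (n : ℝ)) = - (1 / n) := by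
      push_cast; ring
    have e2 : ((n : ℂ))⁻¹ * f (y - (k : ℝ) / (n : ℝ)) +
      ∫ s in (y - (k : ℝ) / (n : ℝ))..(y - ((k + 1 : ℕ) : ℝ) / (n : ℝ)), f s =
      ∫ s in (y - (k : ℝ) / (n : ℝ))..(y - ((k + 1 : ℕ) : ℝ) / (n : ℝ)),
        (f s - f (y - (k : ℝ) / (n : ℝ))) := by
      rw [intervalIntegral.integral_sub (hf.intervalIntegrable _ _)
        (continuous_const.intervalIntegrable _ _), intervalIntegral.integral_const, hlen]
      simp only [Complex.real_smul]
      push_cast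
      ring
    rw [e2]
    have := intervalIntegral.norm_integral_le_of_norm_le_const
      (a := y - (k : ℝ) / (n : ℝ)) (b := y - ((k + 1 : ℕ) : ℝ) / (n : ℝ)) (C := ε)
      (f := fun s => f s - f (y - (k : ℝ) / (n : ℝ))) (by
        intro s hs
        rw [← dist_eq_norm]
        apply (h _).le
        have hp : 0 < 1 / (n : ℝ) := by positivity
        rw [Set.uIoc_of_ge (by linarith)] at hs
        rw [Real.dist_eq, abs_lt]
        constructor <;> linarith [hs.1, hs.2])
    rw [hlen, abs_neg, abs_of_pos (by positivity : 0 < 1 / (n : ℝ))] at this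
    exact this
  calc _ ≤ ∑ k ∈ Finset.range n, ε * (1 / (n : ℝ)) := norm_sum_le_of_le _ hb
    _ = ε := by
      rw [Finset.sum_const, Finset.card_range, nsmul_eq_mul]
      field_simp

/-- Coefficients vanishing at infinity do not imply vanishing at infinity: for
`f` continuous supported in `(0,1)`, the convolution of
`ν = Σ_{n≥1} Σ_{k=0}^{n-1} (1/n) δ_{n+k/n}` with `f` tends to `∫_0^1 f` as
`x → +∞`; in particular if `∫_0^1 f ≠ 0` it does not lie in `C₀(ℝ)`. -/
theorem coefficients_vanishing_does_not_imply_vanishing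
    (f : ℝ → ℂ) (hf : Continuous f) (hsupp : Function.support f ⊆ Set.Ioo 0 1) :
    Tendsto
        (fun x : ℝ => ∑' n : ℕ, ∑ k ∈ Finset.range n,
          ((n : ℂ))⁻¹ * f (x - (n : ℝ) - (k : ℝ) / (n : ℝ)))
        atTop (𝓝 (∫ t in (0:ℝ)..1, f t)) ∧
      ((∫ t in (0:ℝ)..1, f t) ≠ 0 →
        ¬ Tendsto
            (fun x : ℝ => ∑' n : ℕ, ∑ k ∈ Finset.range n,
              ((n : ℂ))⁻¹ * f (x - (n : ℝ) - (k : ℝ) / (n : ℝ)))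
            (cocompact ℝ) (𝓝 0)) := by
  have hz : ∀ s : ℝ, (s ≤ 0 ∨ 1 ≤ s) → f s = 0 := by
    intro s hs
    by_contra hne
    have := hsupp (Function.mem_support.2 hne)
    rcases hs with hs | hs <;> linarith [this.1, this.2]
  have hu : UniformContinuous f := by
    refine Continuous.uniformContinuous_of_tendsto_cocompact (x := 0) hf (HasCompactSupport.is_zero_at_infty ?_)
    refine HasCompactSupport.intro (isCompact_Icc (a := (0:ℝ)) (b := 1)) fun s hs => hz s ?_
    by_contra! hc
    exact hs ⟨hc.1.le, hc.2.le⟩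
  have main : Tendsto
        (fun x : ℝ => ∑' n : ℕ, ∑ k ∈ Finset.range n,
          ((n : ℂ))⁻¹ * f (x - (n : ℝ) - (k : ℝ) / (n : ℝ)))
        atTop (𝓝 (∫ t in (0:ℝ)..1, f t)) := by
    rw [Metric.tendsto_atTop]
    intro ε hε
    obtain ⟨N, hN0, hN⟩ := riemann_unif f hf hu (ε / 3) (by positivity)
    refine ⟨N + 2, fun x hx => ?_⟩
    have hx0 : 0 ≤ x := le_trans (by positivity) hx
    obtain ⟨m, hm⟩ : ∃ m : ℕ, ⌊x⌋₊ = m + 1 := by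
      have : N + 2 ≤ ⌊x⌋₊ := Nat.le_floor (by push_cast; exact hx)
      exact ⟨⌊x⌋₊ - 1, by omega⟩
    have hmN : N ≤ m := by
      have : N + 2 ≤ ⌊x⌋₊ := Nat.le_floor (by push_cast; exact hx)
      omega
    have hl : (m : ℝ) + 1 ≤ x := by
      have := Nat.floor_le hx0
      rw [hm] at this; push_cast at this; exact this
    have hr : x < (m : ℝ) + 2 := by
      have := Nat.lt_floor_add_one x
      rw [hm] at this; push_cast at this; linarith
    have hts : (∑' n : ℕ, ∑ k ∈ Finset.range n,
          ((n : ℂ))⁻¹ * f (x - (n : ℝ) - (k : ℝ) / (n : ℝ))) =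
        ∑ n ∈ ({m, m + 1} : Finset ℕ), ∑ k ∈ Finset.range n,
          ((n : ℂ))⁻¹ * f (x - (n : ℝ) - (k : ℝ) / (n : ℝ)) := by
      apply tsum_eq_sum
      intro n hn
      apply Finset.sum_eq_zero
      intro k hk
      have hkn : k < n := Finset.mem_range.1 hk
      have hnpos : (0 : ℝ) < n := by exact_mod_cast (by omega : 0 < n)
      have hk0 : 0 ≤ (k : ℝ) / n := by positivity
      have hk1 : (k : ℝ) / n < 1 := by
        rw [div_lt_one hnpos]; exact_mod_cast hkn
      rw [hz, mul_zero]
      simp only [Finset.mem_insert, Finset.mem_singleton, not_or] at hn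
      rcases Nat.lt_or_ge n m with h | h
      · right
        have : (n : ℝ) + 1 ≤ m := by exact_mod_cast h
        linarith
      · left
        have : (m : ℝ) + 2 ≤ n := by exact_mod_cast (by omega : m + 2 ≤ n)
        linarith
    rw [hts, Finset.sum_pair (by omega)]
    have h1 := hN m hmN (x - m)
    have h2 := hN (m + 1) (by omega) (x - (m + 1 : ℕ))
    have hi : ∀ a b : ℝ, IntervalIntegrable f volume a b := fun a b => hf.intervalIntegrable a b
    have hI : (∫ t in (0:ℝ)..1, f t) =
        (∫ s in (x - m - 1)..(x - m), f s) +
        ∫ s in (x - (m + 1 : ℕ) - 1)..(x - (m + 1 : ℕ)), f s := by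
      have e : x - ((m + 1 : ℕ) : ℝ) = x - m - 1 := by push_cast; ring
      rw [e, add_comm, intervalIntegral.integral_add_adjacent_intervals (hi _ _) (hi _ _)]
      rw [← intervalIntegral.integral_add_adjacent_intervals (hi (x - m - 1 - 1) 0) (hi 0 (x - m)),
        ← intervalIntegral.integral_add_adjacent_intervals (hi 0 1) (hi 1 (x - m))]
      have z1 : ∫ s in (x - m - 1 - 1)..0, f s = 0 := by
        apply intervalIntegral.integral_zero_ae
        refine Eventually.of_forall fun s hs => hz s (Or.inl ?_)
        rw [Set.uIoc_of_le (by linarith)] at hs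
        exact hs.2
      have z2 : ∫ s in (1:ℝ)..(x - m), f s = 0 := by
        apply intervalIntegral.integral_zero_ae
        refine Eventually.of_forall fun s hs => hz s (Or.inr ?_)
        rw [Set.uIoc_of_le (by linarith)] at hs
        exact hs.1.le
      rw [z1, z2]; simp
    rw [hI, dist_eq_norm, add_sub_add_comm]
    calc _ ≤ ε / 3 + ε / 3 := norm_add_le_of_le h1 h2
      _ < ε := by linarith
  refine ⟨main, fun hne hc => hne ?_⟩
  exact tendsto_nhds_unique main (hc.mono_left atTop_le_cocompact)
end

section
/- The measure μ = Σ_{n∈ℤ, n≠0} (δ_{n+1/n} − δ_n) on ℝ vanishes at infinity: for every f ∈ C_c(ℝ), the function x ↦ Σ_{n∈ℤ, n≠0} ( f(x − n − 1/n) − f(x − n) ) is well defined and belongs to C₀(ℝ). -/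
open MeasureTheory Filter Topology

/-- The measure `μ = Σ_{n ∈ ℤ, n ≠ 0} (δ_{n + 1/n} - δ_n)` on `ℝ` vanishes at
infinity: for every `f ∈ C_c(ℝ)`, the function
`x ↦ Σ_{n ≠ 0} (f(x - n - 1/n) - f(x - n))` is well defined and lies in
`C₀(ℝ)`. -/
theorem example_measure_vanishes_at_infinity
    (f : ℝ → ℂ) (hf : Continuous f) (hfc : HasCompactSupport f) :
    (∀ x : ℝ, Summable (fun n : {n : ℤ // n ≠ 0} =>
        f (x - (n.1 : ℝ) - 1 / (n.1 : ℝ)) - f (x - (n.1 : ℝ)))) ∧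
      Continuous (fun x : ℝ => ∑' n : {n : ℤ // n ≠ 0},
        (f (x - (n.1 : ℝ) - 1 / (n.1 : ℝ)) - f (x - (n.1 : ℝ)))) ∧
      Tendsto (fun x : ℝ => ∑' n : {n : ℤ // n ≠ 0},
          (f (x - (n.1 : ℝ) - 1 / (n.1 : ℝ)) - f (x - (n.1 : ℝ))))
        (cocompact ℝ) (𝓝 0) := by
  obtain ⟨R, hR0, hR⟩ : ∃ R : ℝ, 0 ≤ R ∧ ∀ y : ℝ, R < |y| → f y = 0 := by
    obtain ⟨R, hR⟩ := hfc.isCompact.isBounded.exists_norm_le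
    refine ⟨max R 0, le_max_right _ _, fun y hy => ?_⟩
    by_contra h
    have h1 := hR y (subset_tsupport f h)
    rw [Real.norm_eq_abs] at h1
    have := le_max_left R 0
    linarith
  let S : ℝ → Finset {n : ℤ // n ≠ 0} := fun x =>
    (Finset.Icc ⌈x - R - 2⌉ ⌊x + R + 2⌋).subtype (fun n => n ≠ 0)
  have hS : ∀ x (n : {n : ℤ // n ≠ 0}), n ∈ S x ↔ |x - (n.1 : ℝ)| ≤ R + 2 := by
    intro x n
    simp only [S, Finset.mem_subtype, Finset.mem_Icc, Int.ceil_le, Int.le_floor, abs_le]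
    constructor <;> rintro ⟨h1, h2⟩ <;> constructor <;> linarith
  have hinv : ∀ n : {n : ℤ // n ≠ 0}, |1 / (n.1 : ℝ)| ≤ 1 := by
    intro n
    have h1 : (1 : ℝ) ≤ |(n.1 : ℝ)| := by
      exact_mod_cast Int.one_le_abs n.2
    rw [abs_div, abs_one]
    exact (div_le_one (by linarith)).2 h1
  have hz : ∀ x₀ x : ℝ, |x - x₀| < 1 → ∀ n : {n : ℤ // n ≠ 0}, n ∉ S x₀ →
      f (x - (n.1 : ℝ) - 1 / (n.1 : ℝ)) - f (x - (n.1 : ℝ)) = 0 := by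
    intro x₀ x hx n hn
    rw [hS, not_le] at hn
    have h1 := hinv n
    have h2 : |x₀ - (n.1 : ℝ)| ≤ |x - x₀| + |x - (n.1 : ℝ)| := by
      rw [abs_sub_comm x x₀]; exact abs_sub_le _ _ _
    have h3 := abs_sub_abs_le_abs_sub (x - (n.1 : ℝ)) (1 / (n.1 : ℝ))
    rw [hR _ (by linarith), hR _ (by linarith), sub_zero]
  have hsum : ∀ x₀ x : ℝ, |x - x₀| < 1 → (∑' n : {n : ℤ // n ≠ 0},
      (f (x - (n.1 : ℝ) - 1 / (n.1 : ℝ)) - f (x - (n.1 : ℝ)))) = ∑ n ∈ S x₀,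
      (f (x - (n.1 : ℝ) - 1 / (n.1 : ℝ)) - f (x - (n.1 : ℝ))) :=
    fun x₀ x hx => tsum_eq_sum (hz x₀ x hx)
  have hcard : ∀ x, ((S x).card : ℝ) ≤ 2 * R + 5 := by
    intro x
    have h1 : (S x).card ≤ (⌊x + R + 2⌋ + 1 - ⌈x - R - 2⌉).toNat := by
      rw [← Int.card_Icc]
      simp only [S, Finset.card_subtype]
      exact Finset.card_filter_le _ _
    have h2 : ((S x).card : ℤ) ≤ max (⌊x + R + 2⌋ + 1 - ⌈x - R - 2⌉) 0 := by
      rw [← Int.ofNat_toNat]; exact_mod_cast h1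
    have h3 : ((S x).card : ℝ) ≤ max ((⌊x + R + 2⌋ : ℝ) + 1 - ⌈x - R - 2⌉) 0 := by
      exact_mod_cast h2
    refine h3.trans (max_le ?_ (by linarith))
    have := Int.floor_le (x + R + 2)
    have := Int.le_ceil (x - R - 2)
    linarith
  refine ⟨fun x => summable_of_ne_finset_zero (s := S x) (hz x x (by simp)), ?_, ?_⟩
  · rw [continuous_iff_continuousAt]
    intro x₀
    have hc : Continuous (fun x : ℝ => ∑ n ∈ S x₀,
      (f (x - (n.1 : ℝ) - 1 / (n.1 : ℝ)) - f (x - (n.1 : ℝ)))) := by fun_prop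
    refine hc.continuousAt.congr ?_
    filter_upwards [Metric.ball_mem_nhds x₀ one_pos] with x hx
    exact (hsum x₀ x (by simpa [Real.dist_eq] using hx)).symm
  · have huc := hfc.uniformContinuous_of_continuous hf
    rw [Metric.uniformContinuous_iff] at huc
    rw [Metric.tendsto_nhds]
    intro ε hε
    obtain ⟨δ, hδ, hd⟩ := huc (ε / (2 * R + 6)) (by positivity)
    filter_upwards [(tendsto_norm_cocompact_atTop (E := ℝ)).eventually_gt_atTop
      (R + 2 + 1 / δ)] with x hx
    rw [Real.norm_eq_abs] at hx
    rw [hsum x x (by simp), dist_zero_right]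
    have hb : ∀ n ∈ S x, ‖f (x - (n.1 : ℝ) - 1 / (n.1 : ℝ)) - f (x - (n.1 : ℝ))‖
        ≤ ε / (2 * R + 6) := by
      intro n hn
      rw [hS] at hn
      rw [← dist_eq_norm]
      refine (hd ?_).le
      have h3 := abs_sub_abs_le_abs_sub x (n.1 : ℝ)
      have h4 : 1 / δ < |(n.1 : ℝ)| := by linarith
      rw [Real.dist_eq, sub_sub_cancel_left, abs_neg, abs_div, abs_one]
      exact (one_div_lt hδ (lt_trans (by positivity) h4)).1 h4
    calc _ ≤ ∑ n ∈ S x, ε / (2 * R + 6) := norm_sum_le_of_le _ hb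
      _ = (S x).card * (ε / (2 * R + 6)) := by rw [Finset.sum_const, nsmul_eq_mul]
      _ ≤ (2 * R + 5) * (ε / (2 * R + 6)) := by gcongr; exact hcard x
      _ < (2 * R + 6) * (ε / (2 * R + 6)) := by gcongr; norm_num
      _ = ε := by field_simp
end

section
/- There is a bounded continuous integrable function that vanishes at infinity as a measure but not as a function: define f : ℝ → ℝ by f(x) = Σ_{n=1}^∞ max(0, 1 − 2^n·|x − n|). Then f is continuous, 0 ≤ f ≤ 1, ∫_ℝ f(x) dx = 1, f(n) = 1 for every positive integer n (so f ∉ C₀(ℝ)), f is not uniformly continuous, and for every g ∈ C_c(ℝ) the convolution (f∗g)(x) = ∫_ℝ f(t) g(x−t) dt belongs to C₀(ℝ). -/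
open MeasureTheory Filter Topology

noncomputable def bmp (n : ℕ) (x : ℝ) : ℝ := max 0 (1 - (2 : ℝ) ^ (n + 1) * |x - ((n : ℝ) + 1)|)

lemma bmp_nonneg (n : ℕ) (x : ℝ) : 0 ≤ bmp n x := le_max_left _ _

lemma bmp_le_one (n : ℕ) (x : ℝ) : bmp n x ≤ 1 := by
  unfold bmp
  apply max_le zero_le_one
  have : 0 ≤ (2 : ℝ) ^ (n + 1) * |x - ((n : ℝ) + 1)| := by positivity
  linarith

lemma two_le_pow' (n : ℕ) : (2 : ℝ) ≤ 2 ^ (n + 1) := by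
  have : (1 : ℝ) ≤ 2 ^ n := one_le_pow₀ (by norm_num)
  rw [pow_succ]; linarith

lemma bmp_zero (n : ℕ) (x : ℝ) (h : 1 / 2 ≤ |x - ((n : ℝ) + 1)|) : bmp n x = 0 := by
  unfold bmp
  apply max_eq_left
  nlinarith [two_le_pow' n]

lemma bmp_disj (n m : ℕ) (x : ℝ) (h : |x - ((n : ℝ) + 1)| ≤ 1 / 2) (hm : m ≠ n) :
    bmp m x = 0 := by
  apply bmp_zero
  have h1 : (1 : ℝ) ≤ |(m : ℝ) - n| := by
    have : (1 : ℤ) ≤ |(m : ℤ) - n| := Int.one_le_abs (by omega)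
    exact_mod_cast this
  have h2 := abs_sub_le (m : ℝ) (x - 1) n
  have h3 : |(m : ℝ) - (x - 1)| = |x - (m + 1)| := by rw [abs_sub_comm]; ring_nf
  have h4 : |x - 1 - (n : ℝ)| = |x - (n + 1)| := by ring_nf
  linarith

lemma bmp_tsum (n : ℕ) (x : ℝ) (h : |x - ((n : ℝ) + 1)| ≤ 1 / 2) :
    ∑' m, bmp m x = bmp n x :=
  tsum_eq_single n fun m hm => bmp_disj n m x h hm

lemma bmp_cont (n : ℕ) : Continuous (bmp n) := by
  unfold bmp; fun_prop

lemma bmp_sum_cont : Continuous fun x => ∑' m, bmp m x := by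
  rw [continuous_iff_continuousAt]
  intro x
  obtain ⟨N, hN⟩ := exists_nat_gt (x + 1)
  have hc : Continuous fun y => ∑ m ∈ Finset.range N, bmp m y :=
    continuous_finsetSum _ fun m _ => bmp_cont m
  refine hc.continuousAt.congr ?_
  filter_upwards [Iio_mem_nhds (show x < x + 1 by linarith)] with y hy
  symm
  apply tsum_eq_sum
  intro m hm
  apply bmp_zero
  have : (N : ℝ) ≤ m := by exact_mod_cast (by simpa using hm)
  have hy : y < x + 1 := hy
  rw [abs_sub_comm]
  exact le_trans (by linarith) (le_abs_self _)

lemma bmp_int_base : ∫ x : ℝ, max 0 (1 - |x|) = 1 := by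
  rw [integral_comp_abs (f := fun x => max 0 (1 - x))]
  have h : ∫ x in Set.Ioi (0 : ℝ), max 0 (1 - x) = ∫ x in Set.Ioc (0 : ℝ) 1, max 0 (1 - x) := by
    apply setIntegral_eq_of_subset_of_forall_sdiff_eq_zero measurableSet_Ioi
    · exact fun x hx => hx.1
    · intro x hx
      have : 1 < x := by
        by_contra h
        exact hx.2 ⟨hx.1, not_lt.1 h⟩
      apply max_eq_left; linarith
  have h2 : ∫ x in Set.Ioc (0 : ℝ) 1, max 0 (1 - x) = ∫ x in Set.Ioc (0 : ℝ) 1, (1 - x) := by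
    apply setIntegral_congr_fun measurableSet_Ioc
    intro x hx
    apply max_eq_right; linarith [hx.2]
  rw [h, h2, ← intervalIntegral.integral_of_le zero_le_one,
    intervalIntegral.integral_sub (by simp) (by simp)]
  simp
  norm_num

lemma bmp_integral (n : ℕ) : ∫ x, bmp n x = 1 / 2 / 2 ^ n := by
  have hp : (0 : ℝ) < 2 ^ (n + 1) := by positivity
  have h : ∀ x, bmp n x = (fun z => (fun y : ℝ => max 0 (1 - |y|)) (2 ^ (n + 1) * z)) (x - ((n : ℝ) + 1)) := by
    intro x
    simp [bmp, abs_mul]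
  simp_rw [h]
  rw [integral_sub_right_eq_self (fun z : ℝ => (fun y : ℝ => max 0 (1 - |y|)) (2 ^ (n + 1) * z)),
    Measure.integral_comp_mul_left (fun y : ℝ => max 0 (1 - |y|)), bmp_int_base, abs_of_pos (by positivity)]
  simp [pow_succ]
  ring

lemma bmp_integrable (n : ℕ) : Integrable (bmp n) := by
  apply (bmp_cont n).integrable_of_hasCompactSupport
  apply HasCompactSupport.intro (isCompact_closedBall ((n : ℝ) + 1) (1 / 2))
  intro x hx
  apply bmp_zero
  rw [Metric.mem_closedBall, Real.dist_eq] at hx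
  linarith

lemma bmp_sum_integral : ∫ x, ∑' m, bmp m x = 1 := by
  have h := hasSum_integral_of_summable_integral_norm (F := bmp) (μ := volume) bmp_integrable (by
    simp_rw [Real.norm_of_nonneg (bmp_nonneg _ _), bmp_integral]
    exact summable_geometric_two' 1)
  simp_rw [bmp_integral] at h
  exact h.unique (hasSum_geometric_two' 1)

/-- A bounded continuous integrable function that vanishes at infinity as a
measure but not as a function: `f(x) = Σ_{n≥1} max (0, 1 - 2^n |x - n|)` is
continuous with `0 ≤ f ≤ 1` and `∫ f = 1`, takes the value `1` at every
positive integer (so `f ∉ C₀(ℝ)`), is not uniformly continuous, and yet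
`f ∗ g ∈ C₀(ℝ)` for every `g ∈ C_c(ℝ)`. -/
theorem bounded_continuous_vanishing_as_measure_not_as_function
    (f : ℝ → ℝ)
    (hf : ∀ x : ℝ, f x =
      ∑' n : ℕ, max 0 (1 - (2 : ℝ) ^ (n + 1) * |x - ((n : ℝ) + 1)|)) :
    Continuous f ∧
      (∀ x, 0 ≤ f x ∧ f x ≤ 1) ∧
      (∫ x : ℝ, f x) = 1 ∧
      (∀ n : ℕ, 1 ≤ n → f (n : ℝ) = 1) ∧
      ¬ Tendsto f (cocompact ℝ) (𝓝 0) ∧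
      ¬ UniformContinuous f ∧
      (∀ g : ℝ → ℂ, Continuous g → HasCompactSupport g →
        Continuous (fun x : ℝ => ∫ t : ℝ, (f t : ℂ) * g (x - t)) ∧
          Tendsto (fun x : ℝ => ∫ t : ℝ, (f t : ℂ) * g (x - t))
            (cocompact ℝ) (𝓝 0)) := by
  have hf' : f = fun x => ∑' m, bmp m x := funext hf
  have hcont : Continuous f := hf' ▸ bmp_sum_cont
  have hint : ∫ x : ℝ, f x = 1 := by rw [hf']; exact bmp_sum_integral
  have hI : Integrable f := by
    by_contra h
    rw [integral_undef h] at hint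
    exact zero_ne_one hint
  have hone : ∀ n : ℕ, f ((n : ℝ) + 1) = 1 := by
    intro n
    rw [hf']
    simp only
    rw [bmp_tsum n _ (by simp)]
    simp [bmp]
  refine ⟨hcont, ?_, hint, ?_, ?_, ?_, ?_⟩
  · intro x
    rw [hf']
    refine ⟨tsum_nonneg fun m => bmp_nonneg m x, ?_⟩
    by_cases h : ∃ n : ℕ, |x - ((n : ℝ) + 1)| ≤ 1 / 2
    · obtain ⟨n, hn⟩ := h
      simp only
      rw [bmp_tsum n x hn]
      exact bmp_le_one n x
    · push Not at h
      have : ∀ m, bmp m x = 0 := fun m => bmp_zero m x (h m).le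
      simp [this]
  · intro n hn
    obtain ⟨k, rfl⟩ : ∃ k, n = k + 1 := ⟨n - 1, by omega⟩
    push_cast
    exact hone k
  · intro h
    have h1 : Tendsto (fun n : ℕ => (n : ℝ) + 1) atTop (cocompact ℝ) :=
      (tendsto_atTop_add_const_right _ _ tendsto_natCast_atTop_atTop).mono_right
        atTop_le_cocompact
    have h2 := h.comp h1
    have h3 : f ∘ (fun n : ℕ => (n : ℝ) + 1) = fun _ => 1 := funext hone
    rw [h3] at h2
    exact one_ne_zero (tendsto_nhds_unique tendsto_const_nhds h2)
  · intro h
    rw [Metric.uniformContinuous_iff] at h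
    obtain ⟨δ, hδ, h⟩ := h 1 one_pos
    obtain ⟨n, hn⟩ := exists_pow_lt_of_lt_one hδ (show (1 / 2 : ℝ) < 1 by norm_num)
    have hp : (0 : ℝ) < (1 / 2) ^ (n + 1) := by positivity
    have hle : ((1 : ℝ) / 2) ^ (n + 1) ≤ (1 / 2) ^ n :=
      pow_le_pow_of_le_one (by norm_num) (by norm_num) (Nat.le_succ n)
    have hle2 : ((1 : ℝ) / 2) ^ (n + 1) ≤ 1 / 2 :=
      pow_le_of_le_one (by norm_num) (by norm_num) (Nat.succ_ne_zero n)
    have h0 : f ((n : ℝ) + 1 + (1 / 2) ^ (n + 1)) = 0 := by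
      rw [hf']
      simp only
      rw [bmp_tsum n _ (by rw [add_sub_cancel_left, abs_of_pos hp]; exact hle2)]
      unfold bmp
      rw [add_sub_cancel_left, abs_of_pos hp, ← mul_pow]
      norm_num
    have h4 := @h ((n : ℝ) + 1 + (1 / 2) ^ (n + 1)) ((n : ℝ) + 1) (by
      rw [Real.dist_eq, add_sub_cancel_left, abs_of_pos hp]; linarith)
    rw [h0, hone, Real.dist_eq] at h4
    norm_num at h4
  · intro g hg hgs
    obtain ⟨C, hC⟩ := hg.bounded_above_of_compact_support hgs
    have hbound : ∀ x t : ℝ, ‖(f t : ℂ) * g (x - t)‖ ≤ ‖f t‖ * C := by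
      intro x t
      rw [norm_mul, Complex.norm_real]
      exact mul_le_mul_of_nonneg_left (hC _) (norm_nonneg _)
    have hmeas : ∀ x : ℝ, AEStronglyMeasurable (fun t : ℝ => (f t : ℂ) * g (x - t)) volume := by
      intro x
      apply Continuous.aestronglyMeasurable
      fun_prop
    have hbi : Integrable (fun t => ‖f t‖ * C) volume := hI.norm.mul_const C
    refine ⟨?_, ?_⟩
    · apply continuous_of_dominated hmeas (fun x => Eventually.of_forall (hbound x)) hbi
      exact Eventually.of_forall fun t => by fun_prop
    · have hg0 : Tendsto g (cocompact ℝ) (𝓝 0) := hgs.is_zero_at_infty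
      haveI : (cocompact ℝ).IsCountablyGenerated := by
        rw [cocompact_eq_atBot_atTop]; infer_instance
      have := tendsto_integral_filter_of_dominated_convergence (μ := volume) (l := cocompact ℝ)
        (F := fun x t : ℝ => (f t : ℂ) * g (x - t)) (f := fun _ => 0) (fun t => ‖f t‖ * C)
        (Eventually.of_forall hmeas)
        (Eventually.of_forall fun x => Eventually.of_forall (hbound x)) hbi
        (Eventually.of_forall fun t => by
          have h1 : Tendsto (fun x : ℝ => x - t) (cocompact ℝ) (cocompact ℝ) :=
            (Homeomorph.subRight t).isClosedEmbedding.tendsto_cocompact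
          simpa using (hg0.comp h1).const_mul (f t : ℂ))
      simpa using this
end

section
/- The oscillating dyadic density vanishes at infinity as a measure: define f : ℝ → ℝ by f(x) = (−1)^k if x ∈ [n + k/2^n, n + (k+1)/2^n) for some positive integer n and integer 0 ≤ k ≤ 2^n − 1, and f(x) = 0 for all other x. Then for every g ∈ C_c(ℝ), the function x ↦ ∫_ℝ f(t) g(x−t) dt belongs to C₀(ℝ). -/
open MeasureTheory Filter Topology

lemma osc_formula (f : ℝ → ℝ)
    (hf : ∀ n k : ℕ, 1 ≤ n → k < 2 ^ n →
      ∀ x ∈ Set.Ico ((n : ℝ) + (k : ℝ) / 2 ^ n) ((n : ℝ) + ((k : ℝ) + 1) / 2 ^ n),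
        f x = (-1 : ℝ) ^ k) (x : ℝ) (hx : 1 ≤ x) :
    f x = (-1 : ℝ) ^ ⌊(x - (⌊x⌋₊ : ℝ)) * 2 ^ ⌊x⌋₊⌋₊ := by
  have h1 : (⌊x⌋₊ : ℝ) ≤ x := Nat.floor_le (by linarith)
  have h2 : x < (⌊x⌋₊ : ℝ) + 1 := Nat.lt_floor_add_one x
  have h3 : 1 ≤ ⌊x⌋₊ := Nat.one_le_floor_iff x |>.mpr hx
  generalize ⌊x⌋₊ = n at *
  have hp : (0 : ℝ) < 2 ^ n := by positivity
  have h0 : 0 ≤ (x - n) * 2 ^ n := mul_nonneg (by linarith) hp.le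
  have h4 := Nat.floor_le h0
  have h5 := Nat.lt_floor_add_one ((x - n) * 2 ^ n)
  refine hf n _ h3 ?_ x ⟨?_, ?_⟩
  · rw [Nat.floor_lt h0]
    push_cast
    nlinarith
  · have := (div_le_iff₀ hp).mpr h4
    linarith
  · have := (lt_div_iff₀ hp).mpr h5
    linarith

lemma osc_zero (f : ℝ → ℝ)
    (hf0 : ∀ x : ℝ,
      (¬ ∃ n k : ℕ, 1 ≤ n ∧ k < 2 ^ n ∧
        x ∈ Set.Ico ((n : ℝ) + (k : ℝ) / 2 ^ n) ((n : ℝ) + ((k : ℝ) + 1) / 2 ^ n)) →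
      f x = 0) (x : ℝ) (hx : x < 1) : f x = 0 := by
  apply hf0
  rintro ⟨n, k, hn, hk, h, -⟩
  have h1 : (1 : ℝ) ≤ n := by exact_mod_cast hn
  have h2 : (0 : ℝ) ≤ (k : ℝ) / 2 ^ n := by positivity
  linarith

lemma osc_meas (f : ℝ → ℝ)
    (h1 : ∀ x, 1 ≤ x → f x = (-1 : ℝ) ^ ⌊(x - (⌊x⌋₊ : ℝ)) * 2 ^ ⌊x⌋₊⌋₊)
    (h0 : ∀ x, x < 1 → f x = 0) : Measurable f := by
  have : f = fun x => if x < 1 then 0 else (-1 : ℝ) ^ ⌊(x - (⌊x⌋₊ : ℝ)) * 2 ^ ⌊x⌋₊⌋₊ := by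
    funext x
    split_ifs with h
    · exact h0 x h
    · exact h1 x (not_lt.mp h)
  rw [this]
  refine Measurable.ite measurableSet_Iio measurable_const ?_
  have hfl : Measurable (fun x : ℝ => ⌊x⌋₊) := Nat.measurable_floor
  have ha : Measurable (fun x : ℝ => (⌊x⌋₊ : ℝ)) := (measurable_from_nat (f := fun n : ℕ => (n : ℝ))).comp hfl
  have hb : Measurable (fun x : ℝ => (2 : ℝ) ^ ⌊x⌋₊) := (measurable_from_nat (f := fun n : ℕ => (2 : ℝ) ^ n)).comp hfl
  exact (measurable_from_nat (f := fun n : ℕ => (-1 : ℝ) ^ n)).comp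
    (hfl.comp ((measurable_id.sub ha).mul hb))

lemma osc_step (f : ℝ → ℝ)
    (hf : ∀ n k : ℕ, 1 ≤ n → k < 2 ^ n →
      ∀ x ∈ Set.Ico ((n : ℝ) + (k : ℝ) / 2 ^ n) ((n : ℝ) + ((k : ℝ) + 1) / 2 ^ n),
        f x = (-1 : ℝ) ^ k)
    (G : ℝ → ℂ) (n k : ℕ) (hn : 1 ≤ n) (hk : k < 2 ^ n) :
    ∫ t in ((n : ℝ) + (k : ℝ) / 2 ^ n)..((n : ℝ) + ((k : ℝ) + 1) / 2 ^ n), (f t : ℂ) * G t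
      = (-1) ^ k * ∫ t in ((n : ℝ) + (k : ℝ) / 2 ^ n)..((n : ℝ) + ((k : ℝ) + 1) / 2 ^ n), G t := by
  have hle : (n : ℝ) + (k : ℝ) / 2 ^ n ≤ (n : ℝ) + ((k : ℝ) + 1) / 2 ^ n := by gcongr; linarith
  rw [← intervalIntegral.integral_const_mul, intervalIntegral.integral_of_le hle,
    intervalIntegral.integral_of_le hle, ← integral_Ico_eq_integral_Ioc,
    ← integral_Ico_eq_integral_Ioc]
  refine setIntegral_congr_fun measurableSet_Ico fun t ht => ?_
  rw [hf n k hn hk t ht]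
  push_cast
  rfl

lemma osc_unit (f : ℝ → ℝ)
    (hf : ∀ n k : ℕ, 1 ≤ n → k < 2 ^ n →
      ∀ x ∈ Set.Ico ((n : ℝ) + (k : ℝ) / 2 ^ n) ((n : ℝ) + ((k : ℝ) + 1) / 2 ^ n),
        f x = (-1 : ℝ) ^ k)
    (G : ℝ → ℂ) (hG : Continuous G)
    (hI : ∀ a b : ℝ, IntervalIntegrable (fun t => (f t : ℂ) * G t) volume a b)
    (n : ℕ) (hn : 1 ≤ n) (ε : ℝ) (hε : ∀ t, ‖G t - G (t + 1 / 2 ^ n)‖ ≤ ε) (m : ℕ)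
    (hm : 2 * m ≤ 2 ^ n) :
    ‖∫ t in (n : ℝ)..((n : ℝ) + (2 * m : ℕ) / 2 ^ n), (f t : ℂ) * G t‖ ≤ ε * (m / 2 ^ n) := by
  induction m with
  | zero => simp
  | succ m ih =>
    have ih := ih (by omega)
    have s1 := osc_step f hf G n (2 * m) hn (by omega)
    have s2 := osc_step f hf G n (2 * m + 1) hn (by omega)
    have e1 : ((2 * m + 1 : ℕ) : ℝ) = ((2 * m : ℕ) : ℝ) + 1 := by push_cast; ring
    have e2 : ((2 * (m + 1) : ℕ) : ℝ) = ((2 * m : ℕ) : ℝ) + 1 + 1 := by push_cast; ring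
    rw [e1] at s2
    rw [e2, ← intervalIntegral.integral_add_adjacent_intervals (hI _ _) (hI _ _),
      ← intervalIntegral.integral_add_adjacent_intervals
        (hI ((n : ℝ) + (2 * m : ℕ) / 2 ^ n) ((n : ℝ) + ((2 * m : ℕ) + 1) / 2 ^ n)) (hI _ _),
      s1, s2]
    set a : ℝ := (n : ℝ) + (2 * m : ℕ) / 2 ^ n with ha
    have eb : (n : ℝ) + ((2 * m : ℕ) + 1) / 2 ^ n = a + 1 / 2 ^ n := by rw [ha]; ring
    have ec : (n : ℝ) + ((2 * m : ℕ) + 1 + 1) / 2 ^ n = a + 1 / 2 ^ n + 1 / 2 ^ n := by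
      rw [ha]; ring
    rw [ec, eb]
    have hs : ∫ t in (a + 1 / 2 ^ n)..(a + 1 / 2 ^ n + 1 / 2 ^ n), G t
        = ∫ t in a..(a + 1 / 2 ^ n), G (t + 1 / 2 ^ n) := by
      rw [intervalIntegral.integral_comp_add_right]
    have hsub : (-1 : ℂ) ^ (2 * m) * (∫ t in a..(a + 1 / 2 ^ n), G t)
        + (-1 : ℂ) ^ (2 * m + 1) * (∫ t in (a + 1 / 2 ^ n)..(a + 1 / 2 ^ n + 1 / 2 ^ n), G t)
        = ∫ t in a..(a + 1 / 2 ^ n), (G t - G (t + 1 / 2 ^ n)) := by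
      have hG2 : Continuous fun t : ℝ => G (t + 1 / 2 ^ n) := by fun_prop
      rw [intervalIntegral.integral_sub (hG.intervalIntegrable _ _)
        (hG2.intervalIntegrable _ _),
        hs, pow_succ, pow_mul]
      simp
      ring
    rw [hsub]
    have hb := intervalIntegral.norm_integral_le_of_norm_le_const (a := a) (b := a + 1 / 2 ^ n)
      (f := fun t => G t - G (t + 1 / 2 ^ n)) (C := ε) (fun t _ => hε t)
    have habs : |a + 1 / 2 ^ n - a| = 1 / 2 ^ n := by
      rw [add_sub_cancel_left, abs_of_pos (by positivity)]
    rw [habs] at hb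
    refine (norm_add_le _ _).trans ((add_le_add ih hb).trans (le_of_eq ?_))
    push_cast
    ring

lemma osc_many (f : ℝ → ℝ)
    (hf : ∀ n k : ℕ, 1 ≤ n → k < 2 ^ n →
      ∀ x ∈ Set.Ico ((n : ℝ) + (k : ℝ) / 2 ^ n) ((n : ℝ) + ((k : ℝ) + 1) / 2 ^ n),
        f x = (-1 : ℝ) ^ k)
    (G : ℝ → ℂ) (hG : Continuous G)
    (hI : ∀ a b : ℝ, IntervalIntegrable (fun t => (f t : ℂ) * G t) volume a b)
    (N : ℕ) (hN : 1 ≤ N) (ε : ℝ) (hε : ∀ n ≥ N, ∀ t, ‖G t - G (t + 1 / 2 ^ n)‖ ≤ ε) (j : ℕ) :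
    ‖∫ t in (N : ℝ)..((N + j : ℕ) : ℝ), (f t : ℂ) * G t‖ ≤ j * ε := by
  have hε0 : 0 ≤ ε := (norm_nonneg _).trans (hε N le_rfl 0)
  induction j with
  | zero => simp
  | succ j ih =>
    rw [← intervalIntegral.integral_add_adjacent_intervals (hI _ ((N + j : ℕ) : ℝ)) (hI _ _)]
    obtain ⟨p, hp⟩ : ∃ p, N + j = p + 1 := ⟨N + j - 1, by omega⟩
    have h := osc_unit f hf G hG hI (N + j) (by omega) ε (hε _ (by omega)) (2 ^ p)
      (by rw [hp, pow_succ]; omega)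
    have e : (((N + j : ℕ) : ℝ) + (2 * 2 ^ p : ℕ) / 2 ^ (N + j)) = ((N + (j + 1) : ℕ) : ℝ) := by
      have : ((2 * 2 ^ p : ℕ) : ℝ) / 2 ^ (N + j) = 1 := by
        rw [hp]; push_cast; rw [pow_succ]; field_simp
      rw [this]; push_cast; ring
    rw [e] at h
    have h2 : ε * (((2 ^ p : ℕ) : ℝ) / 2 ^ (N + j)) ≤ ε := by
      have : (((2 ^ p : ℕ) : ℝ) / 2 ^ (N + j)) ≤ 1 := by
        rw [div_le_one (by positivity)]
        push_cast
        exact pow_le_pow_right₀ (by norm_num) (by omega)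
      nlinarith
    refine (norm_add_le _ _).trans ((add_le_add ih (h.trans h2)).trans (le_of_eq ?_))
    push_cast
    ring

/-- The oscillating dyadic density vanishes at infinity as a measure: if
`f(x) = (-1)^k` on `[n + k/2^n, n + (k+1)/2^n)` for `n ≥ 1`, `0 ≤ k ≤ 2^n - 1`,
and `f = 0` elsewhere, then `f ∗ g ∈ C₀(ℝ)` for every `g ∈ C_c(ℝ)`. -/
theorem oscillating_dyadic_density_vanishes_at_infinity
    (f : ℝ → ℝ)
    (hf : ∀ n k : ℕ, 1 ≤ n → k < 2 ^ n →
      ∀ x ∈ Set.Ico ((n : ℝ) + (k : ℝ) / 2 ^ n) ((n : ℝ) + ((k : ℝ) + 1) / 2 ^ n),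
        f x = (-1 : ℝ) ^ k)
    (hf0 : ∀ x : ℝ,
      (¬ ∃ n k : ℕ, 1 ≤ n ∧ k < 2 ^ n ∧
        x ∈ Set.Ico ((n : ℝ) + (k : ℝ) / 2 ^ n) ((n : ℝ) + ((k : ℝ) + 1) / 2 ^ n)) →
      f x = 0)
    (g : ℝ → ℂ) (hg : Continuous g) (hgc : HasCompactSupport g) :
    Continuous (fun x : ℝ => ∫ t : ℝ, (f t : ℂ) * g (x - t)) ∧
      Tendsto (fun x : ℝ => ∫ t : ℝ, (f t : ℂ) * g (x - t))
        (cocompact ℝ) (𝓝 0) := by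
  have F1 := osc_formula f hf
  have F0 := osc_zero f hf0
  have hm := osc_meas f F1 F0
  have hb : ∀ x, ‖(f x : ℂ)‖ ≤ 1 := by
    intro x
    rcases lt_or_ge x 1 with h | h
    · simp [F0 x h]
    · simp [F1 x h]
  have hmC : Measurable (fun x => (f x : ℂ)) := Complex.measurable_ofReal.comp hm
  have hloc : LocallyIntegrable (fun x => (f x : ℂ)) volume :=
    (locallyIntegrable_const (1 : ℝ)).mono hmC.aestronglyMeasurable
      (Eventually.of_forall fun x => by simpa using hb x)
  refine ⟨hgc.continuous_convolution_right (ContinuousLinearMap.mul ℝ ℂ) hloc hg, ?_⟩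
  obtain ⟨R0, hR0⟩ := hgc.isCompact.isBounded.subset_closedBall (0 : ℝ)
  obtain ⟨R, hR⟩ := exists_nat_gt R0
  have hgR : ∀ y : ℝ, g y ≠ 0 → |y| < R := by
    intro y hy
    have := hR0 (subset_tsupport g hy)
    rw [Metric.mem_closedBall, Real.dist_eq, sub_zero] at this
    linarith
  rw [cocompact_eq_atBot_atTop, tendsto_sup]
  constructor
  · refine tendsto_const_nhds.congr' ?_
    filter_upwards [eventually_lt_atBot (1 - R : ℝ)] with x hx
    symm
    refine integral_eq_zero_of_ae (Eventually.of_forall fun t => ?_)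
    rcases lt_or_ge t 1 with h | h
    · simp [F0 t h]
    · have : g (x - t) = 0 := by
        by_contra hc
        have := abs_lt.mp (hgR _ hc)
        linarith
      simp [this]
  · rw [Metric.tendsto_atTop]
    intro ε hε
    have huc := hgc.uniformContinuous_of_continuous hg
    rw [Metric.uniformContinuous_iff] at huc
    have hRp : (0 : ℝ) < 2 * R + 2 := by positivity
    obtain ⟨δ, hδ, H⟩ := huc (ε / (2 * R + 2)) (by positivity)
    obtain ⟨M, hM⟩ := exists_pow_lt_of_lt_one hδ (by norm_num : (1 / 2 : ℝ) < 1)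
    refine ⟨((M + 1 + R : ℕ) : ℝ), fun x hx => ?_⟩
    have hx0 : 0 ≤ x := le_trans (by positivity) hx
    have hfl : M + 1 + R ≤ ⌊x⌋₊ := Nat.le_floor hx
    obtain ⟨N, hN⟩ : ∃ N, ⌊x⌋₊ = N + R := ⟨⌊x⌋₊ - R, by omega⟩
    have hx1 := Nat.floor_le hx0
    have hx2 := Nat.lt_floor_add_one x
    rw [hN] at hx1 hx2
    push_cast at hx1 hx2
    have hG : Continuous (fun t => g (x - t)) := hg.comp (by fun_prop)
    have hI : ∀ a b : ℝ, IntervalIntegrable (fun t => (f t : ℂ) * g (x - t)) volume a b := by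
      intro a b
      refine (hG.intervalIntegrable a b).mono_fun
        (hmC.aestronglyMeasurable.mul hG.aestronglyMeasurable)
        (Eventually.of_forall fun t => ?_)
      simp only [norm_mul]
      exact mul_le_of_le_one_left (norm_nonneg _) (hb t)
    have key := osc_many f hf (fun t => g (x - t)) hG hI N (by omega) (ε / (2 * R + 2))
      (by
        intro n hn t
        rw [← dist_eq_norm]
        refine (H ?_).le
        rw [Real.dist_eq]
        have e : x - t - (x - (t + 1 / 2 ^ n)) = (1 / 2 : ℝ) ^ n := by
          rw [one_div_pow]; ring
        rw [e, abs_of_pos (by positivity)]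
        exact (pow_le_pow_of_le_one (by norm_num) (by norm_num) (by omega)).trans_lt hM)
      (2 * R + 1)
    rw [intervalIntegral.integral_eq_integral_of_support_subset] at key
    · rw [dist_zero_right]
      refine key.trans_lt ?_
      rw [mul_div_assoc', div_lt_iff₀ hRp]
      push_cast
      nlinarith
    · intro t ht
      have h : g (x - t) ≠ 0 := right_ne_zero_of_mul ht
      have := abs_lt.mp (hgR _ h)
      push_cast
      constructor <;> linarith
end

section
/- The measure μ = λ − Σ_{n=1}^∞ (μ_n + μ̃_n), where μ_n = (1/n) Σ_{k=1}^n δ_{n+k/n} and μ̃_n is its reflection, vanishes at infinity: for every f ∈ C_c(ℝ), the function x ↦ ∫_ℝ f(t) dt − Σ_{n=1}^∞ (1/n) Σ_{k=1}^n ( f(x − n − k/n) + f(x + n + k/n) ) is well defined and belongs to C₀(ℝ). -/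
open MeasureTheory Filter Topology

lemma aux_riemann (g : ℝ → ℂ) (hg : Continuous g) (n : ℕ) (hn : 1 ≤ n) (c ε : ℝ)
    (h : ∀ s t : ℝ, |s - t| ≤ 1 / (n : ℝ) → ‖g s - g t‖ ≤ ε) :
    ‖(∫ t in c..(c + 1), g t) - (n : ℂ)⁻¹ * ∑ k ∈ Finset.Icc 1 n, g (c + (k : ℝ) / (n : ℝ))‖ ≤ ε := by
  have hn0 : (0 : ℝ) < n := by exact_mod_cast hn
  have hsum : ∑ k ∈ Finset.Icc 1 n, g (c + (k : ℝ) / (n : ℝ))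
      = ∑ k ∈ Finset.range n, g (c + ((k + 1 : ℕ) : ℝ) / (n : ℝ)) := by
    rw [Finset.range_eq_Ico, Finset.sum_Ico_add' (fun k : ℕ => g (c + (k : ℝ) / (n : ℝ))) 0 n 1]
    rfl
  have hint : (∫ t in c..(c + 1), g t) = ∑ k ∈ Finset.range n,
      ∫ t in (c + (k : ℝ) / n)..(c + ((k + 1 : ℕ) : ℝ) / n), g t := by
    rw [intervalIntegral.sum_integral_adjacent_intervals (a := fun k : ℕ => c + (k : ℝ) / n)
      (fun k _ => hg.intervalIntegrable _ _)]
    simp [hn0.ne']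
  rw [hint, hsum, Finset.mul_sum, ← Finset.sum_sub_distrib]
  have hterm : ∀ k ∈ Finset.range n,
      ‖(∫ t in (c + (k : ℝ) / n)..(c + ((k + 1 : ℕ) : ℝ) / n), g t)
        - (n : ℂ)⁻¹ * g (c + ((k + 1 : ℕ) : ℝ) / (n : ℝ))‖ ≤ ε * (1 / n) := by
    intro k _
    have hd : (c + ((k + 1 : ℕ) : ℝ) / n) - (c + (k : ℝ) / n) = 1 / n := by
      push_cast; ring
    have hc : (n : ℂ)⁻¹ * g (c + ((k + 1 : ℕ) : ℝ) / (n : ℝ)) =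
        ∫ t in (c + (k : ℝ) / n)..(c + ((k + 1 : ℕ) : ℝ) / n),
          g (c + ((k + 1 : ℕ) : ℝ) / (n : ℝ)) := by
      rw [intervalIntegral.integral_const, hd, Complex.real_smul]
      push_cast; simp
    rw [hc, ← intervalIntegral.integral_sub (hg.intervalIntegrable _ _) (by simp)]
    have hpos : (0 : ℝ) < 1 / n := by positivity
    refine (intervalIntegral.norm_integral_le_of_norm_le_const (C := ε) ?_).trans ?_
    · intro t ht
      rw [Set.uIoc_of_le (by linarith)] at ht
      apply h
      rw [abs_le]
      constructor <;> linarith [ht.1, ht.2]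
    · rw [hd, abs_of_pos hpos]
  refine (norm_sum_le_of_le _ hterm).trans ?_
  simp
  field_simp
  exact le_rfl

lemma aux_zero (f : ℝ → ℂ) (M : ℕ) (hM : ∀ x : ℝ, (M : ℝ) < |x| → f x = 0)
    (x : ℝ) (n : ℕ) (h : |x| + M < n) : (n : ℂ)⁻¹ *
        ∑ k ∈ Finset.Icc 1 n,
          (f (x - (n : ℝ) - (k : ℝ) / (n : ℝ)) + f (x + (n : ℝ) + (k : ℝ) / (n : ℝ))) = 0 := by
  rw [Finset.sum_eq_zero, mul_zero]
  intro k _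
  have hk : (0 : ℝ) ≤ (k : ℝ) / n := by positivity
  have := le_abs_self x
  have := neg_abs_le x
  rw [hM, hM, add_zero]
  · rw [lt_abs]; left; linarith
  · rw [lt_abs]; right; linarith

lemma aux_bound (f : ℝ → ℂ) (hfc : HasCompactSupport f) :
    ∃ M : ℕ, ∀ x : ℝ, (M : ℝ) < |x| → f x = 0 := by
  obtain ⟨R, hR⟩ := hfc.isBounded.exists_norm_le
  obtain ⟨M, hM⟩ := exists_nat_ge R
  refine ⟨M, fun x hx => ?_⟩
  by_contra h
  have := hR x (subset_tsupport f h)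
  rw [Real.norm_eq_abs] at this
  linarith

lemma aux_tendsto (f : ℝ → ℂ) (hf : Continuous f) (hfc : HasCompactSupport f) :
    Tendsto (fun x : ℝ => (∫ t : ℝ, f t) - ∑' n : ℕ, (n : ℂ)⁻¹ *
          ∑ k ∈ Finset.Icc 1 n,
            (f (x - (n : ℝ) - (k : ℝ) / (n : ℝ)) + f (x + (n : ℝ) + (k : ℝ) / (n : ℝ))))
        atTop (𝓝 0) := by
  obtain ⟨M, hM⟩ := aux_bound f hfc
  have huc := hfc.uniformContinuous_of_continuous hf
  rw [Metric.tendsto_atTop]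
  intro ε hε
  obtain ⟨δ, hδ, hu⟩ := Metric.uniformContinuous_iff.1 huc (ε / (2 * M + 4)) (by positivity)
  obtain ⟨N, hN⟩ := exists_nat_one_div_lt hδ
  refine ⟨N + M + 3, fun x hx => ?_⟩
  have hx0 : 0 ≤ x := by
    have : (0 : ℝ) ≤ N + M + 3 := by positivity
    linarith
  have hfl : N + M + 3 ≤ ⌊x⌋₊ := Nat.le_floor (by push_cast; exact hx)
  obtain ⟨a, ha⟩ : ∃ a, ⌊x⌋₊ = a + M + 1 := ⟨⌊x⌋₊ - M - 1, by omega⟩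
  have h1 : (a : ℝ) + M + 1 ≤ x := by
    have := Nat.floor_le hx0
    rw [ha] at this; push_cast at this; exact this
  have h2 : x < (a : ℝ) + M + 1 + 1 := by
    have := Nat.lt_floor_add_one x
    rw [ha] at this; push_cast at this; exact this
  have haN : N + 1 ≤ a := by omega
  have hkn : ∀ n : ℕ, ∀ k ∈ Finset.Icc 1 n, (0 : ℝ) < (k : ℝ) / n ∧ (k : ℝ) / n ≤ 1 := by
    intro n k hk
    rw [Finset.mem_Icc] at hk
    have h1 : (1 : ℝ) ≤ k := by exact_mod_cast hk.1
    have h2 : (k : ℝ) ≤ n := by exact_mod_cast hk.2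
    exact ⟨div_pos (by linarith) (by linarith), (div_le_one (by linarith)).2 h2⟩
  have hM0 : (0 : ℝ) ≤ M := by positivity
  rw [tsum_eq_sum (s := Finset.Ico a (a + 2 * M + 3))]
  swap
  · intro n hn
    rw [Finset.sum_eq_zero, mul_zero]
    intro k hk
    obtain ⟨hk0, hk1⟩ := hkn n k hk
    have hn0 : (0 : ℝ) ≤ n := by positivity
    rw [hM, hM, add_zero]
    · rw [lt_abs]; left
      have : (0 : ℝ) ≤ a := by positivity
      linarith
    · rw [Finset.mem_Ico, not_and_or, not_le, not_lt] at hn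
      rw [lt_abs]
      rcases hn with hn | hn
      · left
        have : (n : ℝ) + 1 ≤ a := by exact_mod_cast hn
        linarith
      · right
        have : (a : ℝ) + 2 * M + 3 ≤ n := by exact_mod_cast hn
        linarith
  have hint : (∫ t : ℝ, f t) = ∑ n ∈ Finset.Ico a (a + 2 * M + 3),
      ∫ t in (n : ℝ)..((n : ℝ) + 1), f (x - t) := by
    have hs := intervalIntegral.sum_integral_adjacent_intervals_Ico (μ := volume)
      (f := fun t => f (x - t))
      (a := fun k : ℕ => (k : ℝ)) (m := a) (n := a + 2 * M + 3) (by omega)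
      (fun k _ => (hf.comp (continuous_const.sub continuous_id)).intervalIntegrable _ _)
    simp only [Nat.cast_add, Nat.cast_one] at hs
    rw [hs, ← integral_sub_left_eq_self f volume x, intervalIntegral.integral_eq_integral_of_support_subset]
    intro t ht
    by_contra hcon
    apply ht
    apply hM
    rw [Set.mem_Ioc, not_and_or, not_lt, not_le] at hcon
    rw [lt_abs]
    push_cast at hcon
    rcases hcon with h | h
    · left; linarith
    · right; linarith
  rw [hint, dist_zero_right, ← Finset.sum_sub_distrib]
  have hterm : ∀ n ∈ Finset.Ico a (a + 2 * M + 3),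
      ‖(∫ t in (n : ℝ)..((n : ℝ) + 1), f (x - t)) - (n : ℂ)⁻¹ *
          ∑ k ∈ Finset.Icc 1 n,
            (f (x - (n : ℝ) - (k : ℝ) / (n : ℝ)) + f (x + (n : ℝ) + (k : ℝ) / (n : ℝ)))‖
        ≤ ε / (2 * M + 4) := by
    intro n hn
    rw [Finset.mem_Ico] at hn
    have heq : ∑ k ∈ Finset.Icc 1 n,
            (f (x - (n : ℝ) - (k : ℝ) / (n : ℝ)) + f (x + (n : ℝ) + (k : ℝ) / (n : ℝ)))
        = ∑ k ∈ Finset.Icc 1 n, f (x - ((n : ℝ) + (k : ℝ) / (n : ℝ))) := by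
      refine Finset.sum_congr rfl fun k hk => ?_
      obtain ⟨hk0, hk1⟩ := hkn n k hk
      have hn0 : (0 : ℝ) ≤ n := by positivity
      have ha0 : (0 : ℝ) ≤ a := by positivity
      rw [hM (x + n + k / n), add_zero, sub_sub]
      rw [lt_abs]; left; linarith
    rw [heq]
    refine aux_riemann (fun t => f (x - t)) (hf.comp (continuous_const.sub continuous_id)) n
      (by omega) n _ ?_
    intro s t hst
    have hnn : (N : ℝ) + 1 ≤ n := by exact_mod_cast haN.trans hn.1
    have : 1 / (n : ℝ) ≤ 1 / ((N : ℝ) + 1) := one_div_le_one_div_of_le (by positivity) hnn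
    have hd := @hu (x - s) (x - t) (by
      rw [Real.dist_eq, show x - s - (x - t) = -(s - t) by ring, abs_neg]
      linarith)
    rw [dist_eq_norm] at hd
    exact hd.le
  refine (norm_sum_le_of_le _ hterm).trans_lt ?_
  rw [Finset.sum_const, Nat.card_Ico, nsmul_eq_mul, show a + 2 * M + 3 - a = 2 * M + 3 by omega]
  push_cast
  rw [mul_div_assoc', div_lt_iff₀ (by positivity)]
  nlinarith

/-- The measure `μ = λ - Σ_{n≥1} (μ_n + μ̃_n)`, with
`μ_n = (1/n) Σ_{k=1}^n δ_{n+k/n}`, vanishes at infinity: for every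
`f ∈ C_c(ℝ)`, the function
`x ↦ ∫ f - Σ_{n≥1} (1/n) Σ_{k=1}^n (f(x - n - k/n) + f(x + n + k/n))`
is well defined and lies in `C₀(ℝ)`. -/
theorem lebesgue_minus_riemann_combs_vanishes_at_infinity
    (f : ℝ → ℂ) (hf : Continuous f) (hfc : HasCompactSupport f) :
    (∀ x : ℝ, Summable (fun n : ℕ => (n : ℂ)⁻¹ *
        ∑ k ∈ Finset.Icc 1 n,
          (f (x - (n : ℝ) - (k : ℝ) / (n : ℝ)) + f (x + (n : ℝ) + (k : ℝ) / (n : ℝ))))) ∧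
      Continuous (fun x : ℝ => (∫ t : ℝ, f t) - ∑' n : ℕ, (n : ℂ)⁻¹ *
          ∑ k ∈ Finset.Icc 1 n,
            (f (x - (n : ℝ) - (k : ℝ) / (n : ℝ)) + f (x + (n : ℝ) + (k : ℝ) / (n : ℝ)))) ∧
      Tendsto (fun x : ℝ => (∫ t : ℝ, f t) - ∑' n : ℕ, (n : ℂ)⁻¹ *
          ∑ k ∈ Finset.Icc 1 n,
            (f (x - (n : ℝ) - (k : ℝ) / (n : ℝ)) + f (x + (n : ℝ) + (k : ℝ) / (n : ℝ))))
        (cocompact ℝ) (𝓝 0) := by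
  obtain ⟨M, hM⟩ := aux_bound f hfc
  refine ⟨fun x => ?_, ?_, ?_⟩
  · obtain ⟨N, hN⟩ := exists_nat_gt (|x| + M)
    refine summable_of_ne_finset_zero (s := Finset.range N) fun n hn => ?_
    rw [Finset.mem_range, not_lt] at hn
    have : (N : ℝ) ≤ n := by exact_mod_cast hn
    exact aux_zero f M hM x n (by linarith)
  · refine continuous_const.sub ?_
    rw [continuous_iff_continuousAt]
    intro x
    obtain ⟨N, hN⟩ := exists_nat_gt (|x| + 1 + M)
    have hc : Continuous (fun x : ℝ => ∑ n ∈ Finset.range N, (n : ℂ)⁻¹ *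
          ∑ k ∈ Finset.Icc 1 n,
            (f (x - (n : ℝ) - (k : ℝ) / (n : ℝ)) + f (x + (n : ℝ) + (k : ℝ) / (n : ℝ)))) := by
      fun_prop
    refine hc.continuousAt.congr ?_
    filter_upwards [Metric.ball_mem_nhds x one_pos] with y hy
    rw [Metric.mem_ball, Real.dist_eq] at hy
    have hy' : |y| ≤ |x| + 1 := by
      have := abs_sub_abs_le_abs_sub y x
      linarith
    symm
    refine tsum_eq_sum fun n hn => ?_
    rw [Finset.mem_range, not_lt] at hn
    have : (N : ℝ) ≤ n := by exact_mod_cast hn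
    exact aux_zero f M hM y n (by linarith)
  · rw [cocompact_eq_atBot_atTop, tendsto_sup]
    refine ⟨?_, aux_tendsto f hf hfc⟩
    have h := (aux_tendsto (fun t => f (-t)) (hf.comp continuous_neg)
      (hfc.comp_homeomorph (Homeomorph.neg ℝ))).comp tendsto_neg_atBot_atTop
    refine h.congr fun x => ?_
    simp only [Function.comp]
    rw [integral_neg_eq_self f volume]
    congr 1
    refine tsum_congr fun n => ?_
    congr 1
    refine Finset.sum_congr rfl fun k _ => ?_
    rw [add_comm]
    congr 2 <;> ring
end

section
/- Riemann–Lebesgue lemma for measures on ℝ: let μ₊ and μ₋ be translation bounded positive regular Borel measures on ℝ and let h : ℝ → ℂ be locally integrable, such that for every f ∈ C_c(ℝ) the function ξ ↦ |f̌(ξ)|² h(ξ) is integrable and ∫_ℝ (f∗f̃) dμ₊ − ∫_ℝ (f∗f̃) dμ₋ = ∫_ℝ |f̌(ξ)|² h(ξ) dξ (i.e. the Fourier transform of the signed measure μ = μ₊ − μ₋ is the absolutely continuous measure h·λ). Then μ vanishes at infinity: for every g ∈ C_c(ℝ), the function x ↦ ∫_ℝ g(x−t) dμ₊(t) − ∫_ℝ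 g(x−t) dμ₋(t) belongs to C₀(ℝ). -/
open MeasureTheory Filter Topology Real
open scoped NNReal

noncomputable section RLAux

def rlF (f : ℝ → ℂ) (ξ : ℝ) : ℂ := ∫ x : ℝ, f x * Complex.exp (2 * π * Complex.I * ξ * x)

def rlK (f g : ℝ → ℂ) (x : ℝ) : ℂ := ∫ t : ℝ, f (x - t) * (starRingEnd ℂ) (g (-t))

theorem rl_int {f g : ℝ → ℂ} (hf : Continuous f) (hg : Continuous g) (hcg : HasCompactSupport g)
    (x : ℝ) : Integrable (fun t : ℝ => f (x - t) * (starRingEnd ℂ) (g (-t))) := by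
  apply Continuous.integrable_of_hasCompactSupport
  · exact (hf.comp (by fun_prop)).mul (Complex.continuous_conj.comp (hg.comp (by fun_prop)))
  · apply HasCompactSupport.mul_left
    have h1 : HasCompactSupport (fun t : ℝ => g (-t)) :=
      hcg.comp_homeomorph (Homeomorph.neg ℝ)
    exact h1.comp_left (map_zero _)

theorem rl_Fint {f : ℝ → ℂ} (hf : Continuous f) (hcf : HasCompactSupport f) (ξ : ℝ) :
    Integrable (fun x : ℝ => f x * Complex.exp (2 * π * Complex.I * ξ * x)) := by
  apply Continuous.integrable_of_hasCompactSupport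
  · fun_prop
  · exact hcf.mul_right

theorem rl_F_lin {f g : ℝ → ℂ} (hf : Continuous f) (hcf : HasCompactSupport f)
    (hg : Continuous g) (hcg : HasCompactSupport g) (c : ℂ) (ξ : ℝ) :
    rlF (fun x => f x + c * g x) ξ = rlF f ξ + c * rlF g ξ := by
  unfold rlF
  rw [← integral_const_mul, ← integral_add (rl_Fint hf hcf ξ) ((rl_Fint hg hcg ξ).const_mul c)]
  congr 1; ext x; ring

theorem rl_F_trans (f : ℝ → ℂ) (a ξ : ℝ) :
    rlF (fun x => f (x - a)) ξ = Complex.exp (2 * π * Complex.I * ξ * a) * rlF f ξ := by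
  unfold rlF
  rw [← integral_const_mul, ← integral_add_right_eq_self _ a]
  congr 1; ext x
  simp only [add_sub_cancel_right]
  rw [Complex.ofReal_add, mul_add, Complex.exp_add]
  ring

theorem rl_K_conv (f g : ℝ → ℂ) :
    rlK f g = convolution (fun t => (starRingEnd ℂ) (g (-t))) f
      (ContinuousLinearMap.mul ℝ ℂ) volume := by
  ext x
  simp only [rlK, convolution, ContinuousLinearMap.mul_apply']
  congr 1; ext t; ring

theorem rl_K_cont {f g : ℝ → ℂ} (hf : Continuous f) (hcf : HasCompactSupport f)
    (hg : Continuous g) : Continuous (rlK f g) := by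
  rw [rl_K_conv]
  apply hcf.continuous_convolution_right _ _ hf
  exact (Complex.continuous_conj.comp (hg.comp continuous_neg)).locallyIntegrable

theorem rl_K_supp {f g : ℝ → ℂ} (hcf : HasCompactSupport f)
    (hcg : HasCompactSupport g) : HasCompactSupport (rlK f g) := by
  rw [rl_K_conv]
  refine HasCompactSupport.convolution _ ?_ hcf
  have h1 : HasCompactSupport (fun t : ℝ => g (-t)) :=
      hcg.comp_homeomorph (Homeomorph.neg ℝ)
  exact h1.comp_left (map_zero _)

theorem rl_add {f g : ℝ → ℂ} (hf : Continuous f) (hg : Continuous g) (c : ℂ) :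
    Continuous (fun x => f x + c * g x) := by fun_prop

theorem rl_addc {f g : ℝ → ℂ} (hf : HasCompactSupport f) (hg : HasCompactSupport g) (c : ℂ) :
    HasCompactSupport (fun x => f x + c * g x) := hf.add hg.mul_left

theorem rl_pol (a b : ℂ) (z w : ℂ) : 4 * (a * (starRingEnd ℂ) w) =
    (a + 1 * b) * (starRingEnd ℂ) (z + 1 * w) - (a + (-1) * b) * (starRingEnd ℂ) (z + (-1) * w)
    + Complex.I * ((a + Complex.I * b) * (starRingEnd ℂ) (z + Complex.I * w))
    - Complex.I * ((a + (-Complex.I) * b) * (starRingEnd ℂ) (z + (-Complex.I) * w)) := by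
  simp only [map_add, map_mul, map_neg, map_one, Complex.conj_I]
  linear_combination (2 * a * (starRingEnd ℂ) w - 2 * b * (starRingEnd ℂ) z) * Complex.I_sq

theorem rl_int4 {μ : Measure ℝ} {u A B C D : ℝ → ℂ} (hA : Integrable A μ) (hB : Integrable B μ)
    (hC : Integrable C μ) (hD : Integrable D μ)
    (hu : ∀ x, 4 * u x = A x - B x + Complex.I * C x - Complex.I * D x) :
    4 * ∫ x, u x ∂μ = (∫ x, A x ∂μ) - (∫ x, B x ∂μ) + Complex.I * (∫ x, C x ∂μ)
      - Complex.I * (∫ x, D x ∂μ) := by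
  have h1 : Integrable (fun x => A x - B x) μ := hA.sub hB
  have h2 : Integrable (fun x => A x - B x + Complex.I * C x) μ := h1.add (hC.const_mul _)
  rw [← integral_const_mul, ← integral_const_mul, ← integral_const_mul,
    ← integral_sub hA hB, ← integral_add h1 (hC.const_mul _),
    ← integral_sub h2 (hD.const_mul _)]
  congr 1; ext t
  exact hu t

theorem rl_K_pol {f g : ℝ → ℂ} (hf : Continuous f) (hcf : HasCompactSupport f)
    (hg : Continuous g) (hcg : HasCompactSupport g) (x : ℝ) :
    4 * rlK f g x =
      rlK (fun x => f x + 1 * g x) (fun x => f x + 1 * g x) x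
      - rlK (fun x => f x + (-1) * g x) (fun x => f x + (-1) * g x) x
      + Complex.I * rlK (fun x => f x + Complex.I * g x) (fun x => f x + Complex.I * g x) x
      - Complex.I * rlK (fun x => f x + (-Complex.I) * g x)
          (fun x => f x + (-Complex.I) * g x) x := by
  have H : ∀ c : ℂ, Integrable (fun t : ℝ => (f (x - t) + c * g (x - t)) *
      (starRingEnd ℂ) (f (-t) + c * g (-t))) := fun c =>
    rl_int (rl_add hf hg c) (rl_add hf hg c) (rl_addc hcf hcg c) x
  unfold rlK
  refine rl_int4 (H _) (H _) (H _) (H _) fun t => ?_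
  exact rl_pol _ _ _ _

theorem rl_Kpol_int {f g : ℝ → ℂ} (hf : Continuous f) (hcf : HasCompactSupport f)
    (hg : Continuous g) (hcg : HasCompactSupport g) (μ : Measure ℝ) [IsLocallyFiniteMeasure μ] :
    4 * ∫ x, rlK f g x ∂μ =
      (∫ x, rlK (fun x => f x + 1 * g x) (fun x => f x + 1 * g x) x ∂μ)
      - (∫ x, rlK (fun x => f x + (-1) * g x) (fun x => f x + (-1) * g x) x ∂μ)
      + Complex.I * (∫ x, rlK (fun x => f x + Complex.I * g x)
          (fun x => f x + Complex.I * g x) x ∂μ)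
      - Complex.I * (∫ x, rlK (fun x => f x + (-Complex.I) * g x)
          (fun x => f x + (-Complex.I) * g x) x ∂μ) := by
  have H : ∀ c : ℂ, Integrable (fun x => rlK (fun x => f x + c * g x)
      (fun x => f x + c * g x) x) μ := fun c =>
    Continuous.integrable_of_hasCompactSupport
      (rl_K_cont (rl_add hf hg c) (rl_addc hcf hcg c) (rl_add hf hg c))
      (rl_K_supp (rl_addc hcf hcg c) (rl_addc hcf hcg c))
  refine rl_int4 (H _) (H _) (H _) (H _) fun t => ?_
  exact rl_K_pol hf hcf hg hcg t

def rlHyp (μp μm : Measure ℝ) (h : ℝ → ℂ) : Prop :=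
  ∀ f : ℝ → ℂ, Continuous f → HasCompactSupport f →
      Integrable (fun ξ : ℝ => Complex.ofReal (‖rlF f ξ‖ ^ 2) * h ξ) ∧
      (∫ x : ℝ, rlK f f x ∂μp) - (∫ x : ℝ, rlK f f x ∂μm)
        = ∫ ξ : ℝ, Complex.ofReal (‖rlF f ξ‖ ^ 2) * h ξ

theorem rl_main {μp μm : Measure ℝ} [IsLocallyFiniteMeasure μp] [IsLocallyFiniteMeasure μm]
    {h : ℝ → ℂ} (H : rlHyp μp μm h) {f g : ℝ → ℂ} (hf : Continuous f) (hcf : HasCompactSupport f)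
    (hg : Continuous g) (hcg : HasCompactSupport g) :
    (∫ x : ℝ, rlK f g x ∂μp) - (∫ x : ℝ, rlK f g x ∂μm)
      = ∫ ξ : ℝ, rlF f ξ * (starRingEnd ℂ) (rlF g ξ) * h ξ := by
  have J := fun c : ℂ => (H _ (rl_add hf hg c) (rl_addc hcf hcg c)).1
  have E := fun c : ℂ => (H _ (rl_add hf hg c) (rl_addc hcf hcg c)).2
  have key : 4 * ∫ ξ : ℝ, rlF f ξ * (starRingEnd ℂ) (rlF g ξ) * h ξ =
      (∫ ξ : ℝ, Complex.ofReal (‖rlF (fun x => f x + 1 * g x) ξ‖ ^ 2) * h ξ)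
      - (∫ ξ : ℝ, Complex.ofReal (‖rlF (fun x => f x + (-1) * g x) ξ‖ ^ 2) * h ξ)
      + Complex.I *
        (∫ ξ : ℝ, Complex.ofReal (‖rlF (fun x => f x + Complex.I * g x) ξ‖ ^ 2) * h ξ)
      - Complex.I *
        (∫ ξ : ℝ, Complex.ofReal (‖rlF (fun x => f x + (-Complex.I) * g x) ξ‖ ^ 2) * h ξ) := by
    refine rl_int4 (J _) (J _) (J _) (J _) fun ξ => ?_
    simp only [rl_F_lin hf hcf hg hcg, Complex.ofReal_pow, ← Complex.mul_conj']
    linear_combination (h ξ) * rl_pol (rlF f ξ) (rlF g ξ) (rlF f ξ) (rlF g ξ)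
  have h4 : (4 : ℂ) ≠ 0 := by norm_num
  apply mul_left_cancel₀ h4
  rw [key, mul_sub, rl_Kpol_int hf hcf hg hcg, rl_Kpol_int hf hcf hg hcg,
    ← E, ← E, ← E, ← E]
  ring

theorem rl_tendsto {μp μm : Measure ℝ} [IsLocallyFiniteMeasure μp] [IsLocallyFiniteMeasure μm]
    {h : ℝ → ℂ} (H : rlHyp μp μm h) {f g : ℝ → ℂ} (hf : Continuous f) (hcf : HasCompactSupport f)
    (hg : Continuous g) (hcg : HasCompactSupport g) :
    Tendsto (fun a : ℝ => (∫ x : ℝ, rlK f g (x - a) ∂μp) - (∫ x : ℝ, rlK f g (x - a) ∂μm))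
      (cocompact ℝ) (𝓝 0) := by
  have e : ∀ a : ℝ, (∫ x : ℝ, rlK f g (x - a) ∂μp) - (∫ x : ℝ, rlK f g (x - a) ∂μm) =
      ∫ ξ : ℝ, Real.fourierChar (-(ξ * (-a))) •
        (rlF f ξ * (starRingEnd ℂ) (rlF g ξ) * h ξ) := by
    intro a
    have e1 : ∀ x, rlK f g (x - a) = rlK (fun x => f (x - a)) g x := by
      intro x; unfold rlK; congr 1; ext t; congr 2; ring
    simp_rw [e1]
    rw [rl_main (f := fun x => f (x - a)) H (hf.comp (by fun_prop)) (hcf.comp_homeomorph (Homeomorph.subRight a)) hg hcg]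
    congr 1; ext ξ
    rw [rl_F_trans, Circle.smul_def, Real.fourierChar_apply, smul_eq_mul]
    have : (2 * π * Complex.I * ξ * a : ℂ) = ((2 * π * (-(ξ * -a)) : ℝ) : ℂ) * Complex.I := by
      push_cast; ring
    rw [this]; ring
  simp_rw [e]
  exact (Real.tendsto_integral_exp_smul_cocompact
    (fun ξ => rlF f ξ * (starRingEnd ℂ) (rlF g ξ) * h ξ)).comp
      (Homeomorph.neg ℝ).isClosedEmbedding.tendsto_cocompact

theorem rl_tb {μ : Measure ℝ} {C : ℝ≥0} (hC : ∀ x : ℝ, μ (Set.Icc x (x + 1)) ≤ C) (n : ℕ) (x : ℝ) :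
    μ (Set.Icc x (x + n)) ≤ ((n + 1 : ℕ) * C : ℝ≥0) := by
  induction n with
  | zero =>
    refine le_trans (measure_mono (Set.Icc_subset_Icc_right ?_)) ((hC x).trans ?_) <;> simp
  | succ n ih =>
    have : Set.Icc x (x + (n + 1 : ℕ)) ⊆ Set.Icc x (x + n) ∪ Set.Icc (x + n) (x + n + 1) := by
      intro y hy
      push_cast at hy
      rcases le_total y (x + n) with h | h
      · exact Or.inl ⟨hy.1, h⟩
      · exact Or.inr ⟨h, by linarith [hy.2]⟩
    refine (measure_mono this).trans ((measure_union_le _ _).trans ((add_le_add ih (hC _)).trans ?_))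
    rw [← ENNReal.coe_add]
    refine ENNReal.coe_le_coe.2 (le_of_eq ?_)
    push_cast; ring

/-- error bound -/
theorem rl_err {μ : Measure ℝ} {C : ℝ≥0} (hC : ∀ x : ℝ, μ (Set.Icc x (x + 1)) ≤ C) (N : ℕ)
    {E : ℝ → ℂ} {ε : ℝ} (hE : ∀ x, ‖E x‖ ≤ ε) (hs : ∀ x, (N : ℝ) < |x| → E x = 0) (a : ℝ) :
    ‖∫ x, E (x - a) ∂μ‖ ≤ ε * ((2 * N + 1 : ℕ) * C : ℝ≥0) := by
  have hε : 0 ≤ ε := (norm_nonneg _).trans (hE 0)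
  have hm := rl_tb hC (2 * N) (a - N)
  have h1 : ∫ x, E (x - a) ∂μ = ∫ x in Set.Icc (a - N) (a - N + (2 * N : ℕ)), E (x - a) ∂μ := by
    symm
    apply setIntegral_eq_integral_of_forall_compl_eq_zero
    intro x hx
    apply hs
    by_contra hlt
    apply hx
    have := abs_le.1 (not_lt.1 hlt)
    push_cast
    constructor <;> linarith [this.1, this.2]
  rw [h1]
  refine (norm_setIntegral_le_of_norm_le_const (hm.trans_lt ENNReal.coe_lt_top)
    (fun x _ => hE _)).trans ?_
  apply mul_le_mul_of_nonneg_left _ hε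
  exact ENNReal.toReal_mono ENNReal.coe_ne_top hm

/-- approximation -/
theorem rl_approx {f : ℝ → ℂ} (hf : Continuous f) (hcf : HasCompactSupport f) {N : ℕ}
    (hN : ∀ x, (N : ℝ) < |x| → f x = 0) {ε : ℝ} (hε : 0 < ε) :
    ∃ g : ℝ → ℂ, Continuous g ∧ HasCompactSupport g ∧ (∀ x, ‖rlK f g x - f x‖ ≤ ε) ∧
      ∀ x, ((N + 1 : ℕ) : ℝ) < |x| → rlK f g x = 0 := by
  have huc := hcf.uniformContinuous_of_continuous hf
  obtain ⟨δ, hδ, hd⟩ := Metric.uniformContinuous_iff.1 huc ε hε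
  let r := min δ 1
  have hr : 0 < r := lt_min hδ one_pos
  let φ : ContDiffBump (0 : ℝ) := ⟨r / 2, r, by linarith, by linarith⟩
  have hK : ∀ x, rlK f (fun t => ((φ.normed volume t : ℝ) : ℂ)) x =
      convolution (φ.normed volume) f (ContinuousLinearMap.lsmul ℝ ℝ) volume x := by
    intro x
    simp only [rlK, convolution, ContinuousLinearMap.lsmul_apply, Complex.conj_ofReal,
      φ.normed_neg, Complex.real_smul]
    congr 1; ext t; ring
  refine ⟨fun t => ((φ.normed volume t : ℝ) : ℂ), ?_, ?_, ?_, ?_⟩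
  · exact Complex.continuous_ofReal.comp φ.continuous_normed
  · exact φ.hasCompactSupport_normed.comp_left Complex.ofReal_zero
  · intro x
    rw [hK, ← dist_eq_norm]
    apply φ.dist_normed_convolution_le hf.aestronglyMeasurable
    intro y hy
    exact (hd (lt_of_lt_of_le (Metric.mem_ball.1 hy) (min_le_left _ _))).le
  · intro x hx
    rw [hK, convolution]
    refine integral_eq_zero_of_ae (Eventually.of_forall fun t => ?_)
    by_cases ht : |t| < 1
    · have : f (x - t) = 0 := by
        apply hN
        push_cast at hx
        have := abs_sub_abs_le_abs_sub x t
        linarith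
      simp [this]
    · have : φ.normed volume t = 0 := by
        by_contra h0
        have : t ∈ Function.support (φ.normed volume) := h0
        rw [φ.support_normed_eq] at this
        apply ht
        have h2 := Metric.mem_ball.1 this
        rw [Real.dist_eq, sub_zero] at h2
        exact h2.trans_le (min_le_right _ _)
      simp [this]

theorem rl_cont {g : ℝ → ℂ} (hg : Continuous g) (hcg : HasCompactSupport g) (μ : Measure ℝ)
    [IsLocallyFiniteMeasure μ] : Continuous (fun x : ℝ => ∫ t, g (x - t) ∂μ) := by
  have := hcg.continuous_convolution_right (ContinuousLinearMap.lsmul ℝ ℝ) (μ := μ)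
    (f := fun _ => (1 : ℝ)) (locallyIntegrable_const _) hg
  convert this using 2 with x
  simp [convolution]

end RLAux

/-- Riemann--Lebesgue lemma for measures on `ℝ`: if `μ = μ₊ - μ₋` is a
translation bounded (signed) measure whose Fourier transform is the absolutely
continuous measure `h·λ`, i.e. `⟨f ∗ f̃, μ⟩ = ∫ |f̌(ξ)|² h(ξ) dξ` for all
`f ∈ C_c(ℝ)`, then `μ` vanishes at infinity. -/
theorem riemann_lebesgue_for_measures
    (μp μm : Measure ℝ) [μp.Regular] [μm.Regular]
    (htbp : ∃ C : ℝ≥0, ∀ x : ℝ, μp (Set.Icc x (x + 1)) ≤ C)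
    (htbm : ∃ C : ℝ≥0, ∀ x : ℝ, μm (Set.Icc x (x + 1)) ≤ C)
    (h : ℝ → ℂ) (hloc : LocallyIntegrable h)
    (hFT : ∀ f : ℝ → ℂ, Continuous f → HasCompactSupport f →
      Integrable (fun ξ : ℝ =>
        Complex.ofReal
            (‖∫ x : ℝ, f x * Complex.exp (2 * π * Complex.I * ξ * x)‖ ^ 2) * h ξ) ∧
      (∫ x : ℝ, (∫ t : ℝ, f (x - t) * (starRingEnd ℂ) (f (-t))) ∂μp)
          - (∫ x : ℝ, (∫ t : ℝ, f (x - t) * (starRingEnd ℂ) (f (-t))) ∂μm)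
        = ∫ ξ : ℝ,
            Complex.ofReal
                (‖∫ x : ℝ, f x * Complex.exp (2 * π * Complex.I * ξ * x)‖ ^ 2) * h ξ) :
    ∀ g : ℝ → ℂ, Continuous g → HasCompactSupport g →
      Continuous (fun x : ℝ => (∫ t, g (x - t) ∂μp) - ∫ t, g (x - t) ∂μm) ∧
        Tendsto (fun x : ℝ => (∫ t, g (x - t) ∂μp) - ∫ t, g (x - t) ∂μm)
          (cocompact ℝ) (𝓝 0) := by
  obtain ⟨Cp, hCp⟩ := htbp
  obtain ⟨Cm, hCm⟩ := htbm
  intro g hg hcg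
  refine ⟨(rl_cont hg hcg μp).sub (rl_cont hg hcg μm), ?_⟩
  have H : rlHyp μp μm h := hFT
  let f : ℝ → ℂ := fun x => g (-x)
  have hf : Continuous f := hg.comp continuous_neg
  have hcf : HasCompactSupport f := hcg.comp_homeomorph (Homeomorph.neg ℝ)
  have hfg : ∀ x t, g (x - t) = f (t - x) := fun x t => by simp [f]
  simp_rw [hfg]
  obtain ⟨N, hN⟩ : ∃ N : ℕ, ∀ x, (N : ℝ) < |x| → f x = 0 := by
    obtain ⟨R, hR⟩ := hcf.isCompact.isBounded.subset_closedBall 0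
    obtain ⟨N, hRN⟩ := exists_nat_ge R
    refine ⟨N, fun x hx => image_eq_zero_of_notMem_tsupport fun hx' => ?_⟩
    have := mem_closedBall_zero_iff.1 (hR hx')
    rw [Real.norm_eq_abs] at this
    linarith
  rw [Metric.tendsto_nhds]
  intro ε hε
  let M : ℝ := ((2 * (N + 1) + 1 : ℕ) * Cp : ℝ≥0) + ((2 * (N + 1) + 1 : ℕ) * Cm : ℝ≥0)
  have hM : 0 ≤ M := by positivity
  obtain ⟨k, hk, hck, hk1, hk2⟩ := rl_approx hf hcf hN (ε := ε / (2 * (M + 1))) (by positivity)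
  have hT := rl_tendsto H hf hcf hk hck
  filter_upwards [Metric.tendsto_nhds.1 hT (ε / 2) (by positivity)] with a ha
  rw [dist_zero_right] at ha ⊢
  have hs : ∀ x, ((N + 1 : ℕ) : ℝ) < |x| → rlK f k x - f x = 0 := by
    intro x hx
    rw [hk2 x hx, hN x (by push_cast at hx; linarith), sub_zero]
  have ep := rl_err hCp (N + 1) hk1 hs a
  have em := rl_err hCm (N + 1) hk1 hs a
  have I1 : ∀ (μ : Measure ℝ) [IsLocallyFiniteMeasure μ],
      ∫ x, (rlK f k (x - a) - f (x - a)) ∂μ = (∫ x, rlK f k (x - a) ∂μ) - ∫ x, f (x - a) ∂μ := by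
    intro μ _
    apply integral_sub
    · exact ((rl_K_cont hf hcf hk).comp (continuous_sub_right a)).integrable_of_hasCompactSupport
        ((rl_K_supp hcf hck).comp_homeomorph (Homeomorph.subRight a))
    · exact (hf.comp (continuous_sub_right a)).integrable_of_hasCompactSupport
        (hcf.comp_homeomorph (Homeomorph.subRight a))
  rw [I1] at ep em
  have hb : ε / (2 * (M + 1)) * M < ε / 2 := by
    rw [div_mul_eq_mul_div, div_lt_div_iff₀ (by positivity) (by positivity)]
    nlinarith
  have hMe : ε / (2 * (M + 1)) * M = ε / (2 * (M + 1)) * ((2 * (N + 1) + 1 : ℕ) * Cp : ℝ≥0)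
      + ε / (2 * (M + 1)) * ((2 * (N + 1) + 1 : ℕ) * Cm : ℝ≥0) := mul_add _ _ _
  set A := ∫ x, rlK f k (x - a) ∂μp
  set B := ∫ x, rlK f k (x - a) ∂μm
  set A' := ∫ x, f (x - a) ∂μp
  set B' := ∫ x, f (x - a) ∂μm
  have t1 : ‖A' - B'‖ ≤ ‖A - B‖ + ‖A - A'‖ + ‖B - B'‖ := by
    have : A' - B' = (A - B) - (A - A') + (B - B') := by ring
    rw [this]
    exact (norm_add_le _ _).trans (add_le_add_left (norm_sub_le _ _) _)
  linarith
end

section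
/- Riemann–Lebesgue lemma for measures supported on the lattice ℤ ⊆ ℝ: let c : ℤ → ℂ be bounded and let h : ℝ → ℂ be locally integrable such that for every f ∈ C_c(ℝ) the function ξ ↦ |f̌(ξ)|² h(ξ) is integrable and Σ_{n∈ℤ} c(n) (f∗f̃)(n) = ∫_ℝ |f̌(ξ)|² h(ξ) dξ (i.e. the measure μ = Σ_{n∈ℤ} c(n) δ_n is Fourier transformable with absolutely continuous transform h·λ). Then the coefficients vanish at infinity: c(n) → 0 as |n| → ∞. -/
open MeasureTheory Filter Topology Real

lemma aux_bump : ∃ g : ℝ → ℂ, Continuous g ∧ HasCompactSupport g ∧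
    (∀ x, 1 / 4 ≤ |x| → g x = 0) ∧
    (∫ t : ℝ, g (0 - t) * (starRingEnd ℂ) (g (-t))) ≠ 0 := by
  have hcont : Continuous (fun x : ℝ => max 0 (1 / 4 - |x|)) := by fun_prop
  have hz : ∀ x : ℝ, 1 / 4 ≤ |x| → max 0 (1 / 4 - |x|) = 0 := by
    intro x hx
    exact max_eq_left (by linarith)
  refine ⟨fun x => ((max 0 (1 / 4 - |x|) : ℝ) : ℂ), by fun_prop, ?_, ?_, ?_⟩
  · apply HasCompactSupport.intro (isCompact_Icc (a := (-1 : ℝ)) (b := 1))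
    intro x hx
    have : 1 / 4 ≤ |x| := by
      by_contra hlt
      push Not at hlt
      rw [abs_lt] at hlt
      exact hx ⟨by linarith [hlt.1], by linarith [hlt.2]⟩
    simp only [hz x this, Complex.ofReal_zero]
  · intro x hx
    simp only [hz x hx, Complex.ofReal_zero]
  · have hpos : 0 < ∫ t : ℝ, (max 0 (1 / 4 - |t|)) ^ 2 := by
      apply Continuous.integral_pos_of_hasCompactSupport_nonneg_nonzero (x := 0)
      · fun_prop
      · apply HasCompactSupport.intro (isCompact_Icc (a := (-1 : ℝ)) (b := 1))
        intro x hx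
        have : 1 / 4 ≤ |x| := by
          by_contra hlt
          push Not at hlt
          rw [abs_lt] at hlt
          exact hx ⟨by linarith [hlt.1], by linarith [hlt.2]⟩
        rw [hz x this]; norm_num
      · intro x; positivity
      · norm_num
    have : (∫ t : ℝ, ((max 0 (1 / 4 - |0 - t|) : ℝ) : ℂ) *
        (starRingEnd ℂ) ((max 0 (1 / 4 - |-t|) : ℝ) : ℂ))
        = ((∫ t : ℝ, (max 0 (1 / 4 - |t|)) ^ 2 : ℝ) : ℂ) := by
      rw [← integral_complex_ofReal]
      congr 1
      ext t
      rw [Complex.conj_ofReal, zero_sub, abs_neg]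
      push_cast
      ring
    rw [this]
    exact_mod_cast hpos.ne'

lemma aux_int {g : ℝ → ℂ} (hg : Continuous g) (hs : HasCompactSupport g) (a b : ℝ) :
    Integrable (fun t : ℝ => g (a - t) * (starRingEnd ℂ) (g (b - t))) := by
  apply Continuous.integrable_of_hasCompactSupport
  · fun_prop
  · apply HasCompactSupport.mul_right
    exact hs.comp_homeomorph (Homeomorph.subLeft a)

lemma aux_conv {g : ℝ → ℂ} (hg : Continuous g) (hs : HasCompactSupport g)
    (w : ℂ) (hw : w * (starRingEnd ℂ) w = 1) (N n : ℝ) :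
    (∫ t : ℝ, (g (n - t) + w * g (n - t - N)) *
        (starRingEnd ℂ) (g (-t) + w * g (-t - N))) =
      2 * (∫ t : ℝ, g (n - t) * (starRingEnd ℂ) (g (-t)))
      + w * (∫ t : ℝ, g (n - N - t) * (starRingEnd ℂ) (g (-t)))
      + (starRingEnd ℂ) w * (∫ t : ℝ, g (n + N - t) * (starRingEnd ℂ) (g (-t))) := by
  have e1 : (∫ t : ℝ, g (n + N - t) * (starRingEnd ℂ) (g (-t)))
      = ∫ t : ℝ, g (n - t) * (starRingEnd ℂ) (g (-N - t)) := by
    rw [← integral_add_right_eq_self _ N]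
    congr 1; ext t
    rw [show n + N - (t + N) = n - t by ring, show -(t + N) = -N - t by ring]
  have e2 : (∫ t : ℝ, g (n - t) * (starRingEnd ℂ) (g (-t)))
      = ∫ t : ℝ, g (n - N - t) * (starRingEnd ℂ) (g (-N - t)) := by
    rw [← integral_add_right_eq_self _ N]
    congr 1; ext t
    rw [show n - (t + N) = n - N - t by ring, show -(t + N) = -N - t by ring]
  have i1 := aux_int hg hs n 0
  have i2 := (aux_int hg hs (n - N) 0).const_mul w
  have i3 := (aux_int hg hs n (-N)).const_mul ((starRingEnd ℂ) w)
  have i4 := aux_int hg hs (n - N) (-N)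
  simp only [zero_sub] at i1 i2
  rw [two_mul]
  nth_rewrite 2 [e2]
  rw [e1, ← integral_const_mul, ← integral_const_mul, ← integral_add' i1 i4,
    ← integral_add' (i1.add i4) i2, ← integral_add' ((i1.add i4).add i2) i3]
  congr 1; ext t
  simp only [map_add, map_mul, Pi.add_apply]
  rw [show n - t - N = n - N - t by ring, show -t - N = -N - t by ring]
  linear_combination (g (n - N - t) * (starRingEnd ℂ) (g (-N - t))) * hw

lemma aux_K {g : ℝ → ℂ} (hz : ∀ x, 1 / 4 ≤ |x| → g x = 0) (m : ℤ) (hm : m ≠ 0) :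
    (∫ t : ℝ, g ((m : ℝ) - t) * (starRingEnd ℂ) (g (-t))) = 0 := by
  have : (fun t : ℝ => g ((m : ℝ) - t) * (starRingEnd ℂ) (g (-t))) = fun _ => 0 := by
    ext t
    by_cases h1 : 1 / 4 ≤ |(-t)|
    · rw [hz _ h1]; simp
    · rw [hz ((m : ℝ) - t)]
      · simp
      · have h2 : (1 : ℝ) ≤ |(m : ℝ)| := by exact_mod_cast Int.one_le_abs hm
        have h3 := abs_sub_abs_le_abs_sub (m : ℝ) t
        rw [abs_neg] at h1
        linarith
  rw [this]; simp

lemma aux_fourier {g : ℝ → ℂ} (hg : Continuous g) (hs : HasCompactSupport g)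
    (w : ℂ) (N ξ : ℝ) :
    (∫ x : ℝ, (g x + w * g (x - N)) * Complex.exp (2 * π * Complex.I * ξ * x))
     = (∫ x : ℝ, g x * Complex.exp (2 * π * Complex.I * ξ * x)) *
        (1 + w * Complex.exp (2 * π * Complex.I * ξ * N)) := by
  have i1 : Integrable (fun x : ℝ => g x * Complex.exp (2 * π * Complex.I * ξ * x)) := by
    apply Continuous.integrable_of_hasCompactSupport
    · fun_prop
    · exact hs.mul_right
  have i2 := (i1.comp_sub_right N).const_mul (w * Complex.exp (2 * π * Complex.I * ξ * N))
  rw [mul_add, mul_one, mul_comm _ (w * _)]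
  nth_rewrite 2 [← integral_sub_right_eq_self (fun x : ℝ => g x * Complex.exp (2 * π * Complex.I * ξ * x)) N]
  rw [← integral_const_mul, ← integral_add i1 i2]
  congr 1; ext x
  have : Complex.exp (2 * π * Complex.I * ξ * x) = Complex.exp (2 * π * Complex.I * ξ * N) *
      Complex.exp (2 * π * Complex.I * ξ * ((x - N : ℝ) : ℂ)) := by
    rw [← Complex.exp_add]; congr 1; push_cast; ring
  rw [add_mul]
  nth_rewrite 2 [this]
  ring

lemma aux_conj_exp (ξ N : ℝ) : (starRingEnd ℂ) (Complex.exp (2 * π * Complex.I * ξ * N)) =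
    Complex.exp (2 * π * Complex.I * ξ * ((-N : ℝ) : ℂ)) := by
  rw [← Complex.exp_conj]
  congr 1
  have h2 : (starRingEnd ℂ) (2 : ℂ) = 2 := Complex.conj_ofNat 2
  simp [h2]

lemma aux_norm (z w : ℂ) (hw : w * (starRingEnd ℂ) w = 1) (N ξ : ℝ) :
    Complex.ofReal (‖z * (1 + w * Complex.exp (2 * π * Complex.I * ξ * N))‖ ^ 2) =
    Complex.ofReal (‖z‖ ^ 2) * (2 + w * Complex.exp (2 * π * Complex.I * ξ * N)
      + (starRingEnd ℂ) w * Complex.exp (2 * π * Complex.I * ξ * ((-N : ℝ) : ℂ))) := by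
  have hE : Complex.exp (2 * π * Complex.I * ξ * N) *
      Complex.exp (2 * π * Complex.I * ξ * ((-N : ℝ) : ℂ)) = 1 := by
    rw [← Complex.exp_add, ← Complex.exp_zero]; congr 1; push_cast; ring
  rw [norm_mul, mul_pow]
  push_cast
  rw [← Complex.mul_conj' (1 + _)]
  simp only [map_add, map_mul, map_one]
  have hce := aux_conj_exp ξ N
  push_cast at hce hE
  rw [hce]
  linear_combination ((‖z‖ : ℂ) ^ 2) * (Complex.exp (2 * π * Complex.I * ξ * N) *
      Complex.exp (2 * π * Complex.I * ξ * (-(N : ℂ)))) * hw + ((‖z‖ : ℂ) ^ 2) * hE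

lemma aux_expint {F : ℝ → ℂ} (hF : Integrable F) (N : ℝ) :
    Integrable (fun ξ : ℝ => F ξ * Complex.exp (2 * π * Complex.I * ξ * N)) := by
  apply hF.mul_bdd (c := 1)
  · exact (by fun_prop : Continuous (fun ξ : ℝ =>
      Complex.exp (2 * π * Complex.I * ξ * N))).aestronglyMeasurable
  · refine Eventually.of_forall fun ξ => ?_
    rw [show (2 * π * Complex.I * ξ * N : ℂ) = ((2 * π * ξ * N : ℝ) : ℂ) * Complex.I by
      push_cast; ring, Complex.norm_exp_ofReal_mul_I]

lemma aux_rl (F : ℝ → ℂ) :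
    Tendsto (fun n : ℤ => ∫ ξ : ℝ, F ξ * Complex.exp (2 * π * Complex.I * ξ * ((n : ℝ) : ℂ)))
      (cocompact ℤ) (𝓝 0) := by
  have h1 := Real.tendsto_integral_exp_smul_cocompact F
  have h2 : Tendsto (fun n : ℤ => -(n : ℝ)) (cocompact ℤ) (cocompact ℝ) :=
    (Homeomorph.neg ℝ).isClosedEmbedding.tendsto_cocompact.comp
      Int.isClosedEmbedding_coe_real.tendsto_cocompact
  refine (h1.comp h2).congr fun n => ?_
  simp only [Function.comp]
  congr 1; ext ξ
  rw [Circle.smul_def, Real.fourierChar_apply, smul_eq_mul, mul_comm]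
  congr 2
  push_cast; ring

/-- Riemann--Lebesgue lemma for measures supported on the lattice `ℤ ⊆ ℝ`: if
`c : ℤ → ℂ` is bounded and the measure `μ = Σ_n c(n) δ_n` is Fourier
transformable with absolutely continuous transform `h·λ`, i.e.
`Σ_n c(n) (f ∗ f̃)(n) = ∫ |f̌(ξ)|² h(ξ) dξ` for all `f ∈ C_c(ℝ)`, then
`c(n) → 0` as `|n| → ∞`. -/
theorem riemann_lebesgue_for_lattice_measures
    (c : ℤ → ℂ) (hc : ∃ C : ℝ, ∀ n : ℤ, ‖c n‖ ≤ C)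
    (h : ℝ → ℂ) (hloc : LocallyIntegrable h)
    (hFT : ∀ f : ℝ → ℂ, Continuous f → HasCompactSupport f →
      Integrable (fun ξ : ℝ =>
        Complex.ofReal
            (‖∫ x : ℝ, f x * Complex.exp (2 * π * Complex.I * ξ * x)‖ ^ 2) * h ξ) ∧
      ∑' n : ℤ, c n * (∫ t : ℝ, f ((n : ℝ) - t) * (starRingEnd ℂ) (f (-t)))
        = ∫ ξ : ℝ,
            Complex.ofReal
                (‖∫ x : ℝ, f x * Complex.exp (2 * π * Complex.I * ξ * x)‖ ^ 2) * h ξ) :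
    Tendsto c (cocompact ℤ) (𝓝 0) := by
  obtain ⟨g, hg, hs, hz, hK⟩ := aux_bump
  set F : ℝ → ℂ := fun ξ : ℝ => Complex.ofReal
            (‖∫ x : ℝ, g x * Complex.exp (2 * π * Complex.I * ξ * x)‖ ^ 2) * h ξ with hFdef
  have hF : Integrable F := (hFT g hg hs).1
  set K : ℝ → ℂ := fun y => ∫ t : ℝ, g (y - t) * (starRingEnd ℂ) (g (-t)) with hKdef
  have hK0 : K 0 ≠ 0 := hK
  have hKm : ∀ m : ℤ, m ≠ 0 → K m = 0 := fun m hm => aux_K hz m hm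
  set I : ℝ → ℂ := fun N => ∫ ξ : ℝ, F ξ * Complex.exp (2 * π * Complex.I * ξ * (N : ℂ))
    with hI
  have hsum : ∀ m : ℤ, HasSum (fun n : ℤ => c n * K ((n : ℝ) - m)) (c m * K 0) := by
    intro m
    have := hasSum_single (f := fun n : ℤ => c n * K ((n : ℝ) - m)) m (by
      intro n hn
      have := hKm (n - m) (sub_ne_zero.mpr hn)
      push_cast at this
      simp only [this, mul_zero])
    simpa using this
  have hrel0 : c 0 * K 0 = ∫ ξ, F ξ := by
    rw [← (hFT g hg hs).2]
    have := (hsum 0).tsum_eq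
    rw [← this]
    simp [hKdef]
  have hrel : ∀ (w : ℂ), w * (starRingEnd ℂ) w = 1 → ∀ N : ℤ,
      2 * (c 0 * K 0) + w * (c N * K 0) + (starRingEnd ℂ) w * (c (-N) * K 0) =
      2 * (∫ ξ, F ξ) + w * I N + (starRingEnd ℂ) w * I (-N) := by
    intro w hw N
    have hfc : Continuous (fun x : ℝ => g x + w * g (x - N)) := by fun_prop
    have hfs : HasCompactSupport (fun x : ℝ => g x + w * g (x - N)) :=
      hs.add (HasCompactSupport.mul_left (hs.comp_homeomorph (Homeomorph.subRight (N : ℝ))))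
    have key := (hFT _ hfc hfs).2
    have hL : HasSum (fun n : ℤ => c n * (∫ t : ℝ, (g ((n : ℝ) - t) + w * g ((n : ℝ) - t - N)) *
        (starRingEnd ℂ) (g (-t) + w * g (-t - N))))
        (2 * (c 0 * K 0) + w * (c N * K 0) + (starRingEnd ℂ) w * (c (-N) * K 0)) := by
      have := (((hsum 0).mul_left 2).add ((hsum N).mul_left w)).add
        ((hsum (-N)).mul_left ((starRingEnd ℂ) w))
      refine (congrArg (fun φ : ℤ → ℂ => HasSum φ _) (funext fun n => ?_)).mpr this
      rw [aux_conv hg hs w hw]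
      simp only [hKdef]
      push_cast
      simp only [sub_zero, sub_neg_eq_add]
      ring
    rw [hL.tsum_eq] at key
    rw [key]
    have i1 := hF.const_mul 2
    have i2 := (aux_expint hF N).const_mul w
    have i3 := (aux_expint hF (-N)).const_mul ((starRingEnd ℂ) w)
    simp only [hI]
    rw [← integral_const_mul, ← integral_const_mul, ← integral_const_mul,
      ← integral_add' i1 i2, ← integral_add' (i1.add i2) i3]
    congr 1; ext ξ
    rw [aux_fourier hg hs, aux_norm _ _ hw]
    simp only [hFdef, Pi.add_apply]
    ring
  have hfin : ∀ N : ℤ, c N = I N * (K 0)⁻¹ := by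
    intro N
    have r1 := hrel 1 (by simp) N
    have r2 := hrel Complex.I (by simp) N
    rw [hrel0] at r1 r2
    simp only [map_one, Complex.conj_I] at r1 r2
    rw [eq_mul_inv_iff_mul_eq₀ hK0]
    linear_combination (1 / 2) * r1 - (Complex.I / 2) * r2 + (1 / 2 * (c N * K 0 - I N) - 1 / 2 * (c (-N) * K 0 - I (-N))) * Complex.I_sq
  have hlim : Tendsto (fun N : ℤ => I N * (K 0)⁻¹) (cocompact ℤ) (𝓝 0) := by
    have := (aux_rl F).mul_const (K 0)⁻¹
    rw [zero_mul] at this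
    exact this
  exact hlim.congr fun N => (hfin N).symm
end
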